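/- arXiv:1109.5300 — 6 statements merged into one kernel-verified Lean document; each statement's English description precedes it below -/
import Mathlib

section
/- There exists a symmetric generating set Σ for the group ℤ_ω = ⨁_{ℵ_0} ℤ such that the Cayley graph Cay(ℤ_ω,Σ), endowed with the word metric, does not coarsely embed into any metric space of non zero generalized roundness: if (B,d) is a metric space with 𝔮(B) > 0 (including 𝔮(B) = ∞), there is no coarse embedding of (ℤ_ω, d_Σ) into B. -/
/-- The set of exponents `p ≥ 0` for which the generalized roundness inequality holds in
the space with distance function `d`. -/
def grSet {X : Type*} (d : X → X → ℝ) : Set ℝ :=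
  {p | 0 ≤ p ∧ ∀ n : ℕ, 2 ≤ n → ∀ x y : Fin n → X,
    (∑ i, ∑ j, if i < j then d (x i) (x j) ^ p + d (y i) (y j) ^ p else 0) ≤
      ∑ i, ∑ j, d (x i) (y j) ^ p}

/-- The generalized roundness `𝔮` of the space with distance function `d`,
valued in `ℝ≥0∞`. -/
noncomputable def genRoundness {X : Type*} (d : X → X → ℝ) : ENNReal :=
  sSup (ENNReal.ofReal '' grSet d)

/-- `f` is a coarse embedding of the space with distance function `dX` into the space
with distance function `dY`: there are non-decreasing `ρ₁, ρ₂` with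
`ρ₁(dX a b) ≤ dY (f a) (f b) ≤ ρ₂(dX a b)` and `ρ₁(t) → ∞` as `t → ∞`. -/
def IsCoarseEmbeddingWith {X Y : Type*} (dX : X → X → ℝ) (dY : Y → Y → ℝ)
    (f : X → Y) : Prop :=
  ∃ ρ₁ ρ₂ : ℝ → ℝ, Monotone ρ₁ ∧ Monotone ρ₂ ∧
    (∀ a b, ρ₁ (dX a b) ≤ dY (f a) (f b) ∧ dY (f a) (f b) ≤ ρ₂ (dX a b)) ∧
    Filter.Tendsto ρ₁ Filter.atTop Filter.atTop

/-- `f` is a uniform embedding of the space with distance function `dX` into the space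
with distance function `dY`: `f` is injective and both `f` and `f⁻¹` (on the range of
`f`) are uniformly continuous. -/
def IsUniformEmbeddingWith {X Y : Type*} (dX : X → X → ℝ) (dY : Y → Y → ℝ)
    (f : X → Y) : Prop :=
  Function.Injective f ∧
    (∀ ε : ℝ, 0 < ε → ∃ δ : ℝ, 0 < δ ∧ ∀ a b, dX a b < δ → dY (f a) (f b) < ε) ∧
    (∀ ε : ℝ, 0 < ε → ∃ δ : ℝ, 0 < δ ∧ ∀ a b, dY (f a) (f b) < δ → dX a b < ε)

/-- The word metric on an (additive) group `G` with respect to a generating set `S`: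
`wordDist S a b` is the least `k` such that `b − a` is a sum of `k` elements of `S`. -/
noncomputable def wordDist {G : Type*} [AddCommGroup G] (S : Set G) (a b : G) : ℕ :=
  sInf {k : ℕ | ∃ w : Fin k → G, (∀ i, w i ∈ S) ∧ ∑ i, w i = b - a}

/-- `S` is a symmetric generating set of the (additive) group `G`:
`−S = S`, `0 ∉ S`, and every element of `G` is a sum of elements of `S`. -/
def IsSymmGenSet {G : Type*} [AddCommGroup G] (S : Set G) : Prop :=
  (∀ s ∈ S, -s ∈ S) ∧ (0 : G) ∉ S ∧
    ∀ x : G, ∃ (k : ℕ) (w : Fin k → G), (∀ i, w i ∈ S) ∧ ∑ i, w i = x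

section
variable {ι : Type*} [Fintype ι]

lemma Complex.one_sub_re_pow_le {z : ℂ} (hz : ‖z‖ = 1) (k : ℕ) :
    1 - (z ^ k).re ≤ (k : ℝ) ^ 2 * (1 - z.re) := by
  have key : ∀ w : ℂ, ‖w‖ = 1 → 1 - w.re = ‖1 - w‖ ^ 2 / 2 := by
    intro w hw
    have h1 := Complex.sq_norm w
    have h2 := Complex.sq_norm (1 - w)
    rw [hw, Complex.normSq_apply] at h1
    rw [h2, Complex.normSq_apply]
    simp
    nlinarith
  have hk : ‖1 - z ^ k‖ ≤ k * ‖1 - z‖ := by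
    rw [← mul_neg_geom_sum, mul_comm, norm_mul]
    refine mul_le_mul_of_nonneg_right ?_ (norm_nonneg _)
    refine (norm_sum_le _ _).trans ?_
    simp [hz]
  rw [key _ (by simp [hz]), key z hz]
  have := pow_le_pow_left₀ (norm_nonneg _) hk 2
  nlinarith

lemma Complex.norm_one_add_div_two_le {z : ℂ} (hz : ‖z‖ = 1) :
    ‖(1 + z) / 2‖ ≤ 1 - (1 - z.re) / 4 := by
  have h1 := Complex.sq_norm z
  rw [hz, Complex.normSq_apply] at h1
  have hre : -1 ≤ z.re := by nlinarith [sq_nonneg z.im]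
  refine le_of_sq_le_sq ?_ (by linarith)
  rw [Complex.sq_norm, Complex.normSq_apply]
  simp
  nlinarith [sq_nonneg (1 - z.re)]

lemma prod_one_sub_le_inv_one_add_sum (v : ι → ℝ) (h0 : ∀ i, 0 ≤ v i) (h1 : ∀ i, v i ≤ 1) :
    ∏ i, (1 - v i) ≤ (1 + ∑ i, v i)⁻¹ := by
  calc ∏ i, (1 - v i) ≤ ∏ i, Real.exp (-v i) :=
        Finset.prod_le_prod (fun i _ => by linarith [h1 i])
          fun i _ => by linarith [Real.add_one_le_exp (-v i)]
    _ = (Real.exp (∑ i, v i))⁻¹ := by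
        rw [← Real.exp_sum, Finset.sum_neg_distrib, Real.exp_neg]
    _ ≤ _ := by
        have : 0 ≤ ∑ i, v i := Finset.sum_nonneg fun i _ => h0 i
        gcongr
        linarith [Real.add_one_le_exp (∑ i, v i)]

/-- The scalar form of the cotype inequality. -/
lemma sum_one_sub_re_pow_le (z : ι → ℂ) (hz : ∀ i, ‖z i‖ = 1) {k : ℕ}
    (hk : k ^ 2 ≤ Fintype.card ι) :
    (∑ i, (1 - (z i ^ k).re)) * 2 ^ Fintype.card ι ≤
      8 * Fintype.card ι * ∑ t : Finset ι, (1 - (∏ i ∈ t, z i).re) := by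
  set m := Fintype.card ι
  have hb : ∀ w : ℂ, ‖w‖ = 1 → 1 - w.re ≤ 2 ∧ 0 ≤ 1 - w.re := fun w hw => by
    have := abs_le.1 (Complex.abs_re_le_norm w)
    constructor <;> linarith
  set v : ι → ℝ := fun i => (1 - (z i).re) / 4 with hv
  have hv0 : ∀ i, 0 ≤ v i := fun i => by have := hb _ (hz i); simp only [hv]; linarith
  have hv1 : ∀ i, v i ≤ 1 := fun i => by have := hb _ (hz i); simp only [hv]; linarith
  set V := ∑ i, v i
  have hV0 : 0 ≤ V := Finset.sum_nonneg fun i _ => hv0 i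
  have hkm : (k : ℝ) ^ 2 ≤ m := by exact_mod_cast hk
  have hL1 : ∑ i, (1 - (z i ^ k).re) ≤ m * (4 * V) := by
    rw [Finset.mul_sum, Finset.mul_sum]
    refine Finset.sum_le_sum fun i _ => (Complex.one_sub_re_pow_le (hz i) k).trans ?_
    have : 4 * v i = 1 - (z i).re := by simp only [hv]; ring
    rw [this]
    exact mul_le_mul_of_nonneg_right hkm (hb _ (hz i)).2
  have hL2 : ∑ i, (1 - (z i ^ k).re) ≤ m * 2 := by
    refine (Finset.sum_le_card_nsmul _ _ 2 fun i _ => (hb _ (by simp [hz])).1).trans ?_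
    simp [m]
  have hP : (∑ t : Finset ι, (∏ i ∈ t, z i).re) ≤ 2 ^ m * (1 + V)⁻¹ := by
    have h1 : ∑ t : Finset ι, ∏ i ∈ t, z i = 2 ^ m * ∏ i, ((1 + z i) / 2) := by
      rw [Finset.prod_div_distrib, Finset.prod_one_add]
      simp only [Finset.powerset_univ, Finset.prod_const, Finset.card_univ]
      field_simp
      rfl
    rw [← Complex.re_sum, h1]
    refine (Complex.re_le_norm _).trans ?_
    rw [norm_mul, norm_pow, norm_prod, Complex.norm_ofNat]
    gcongr
    exact (Finset.prod_le_prod (fun i _ => norm_nonneg _)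
      fun i _ => Complex.norm_one_add_div_two_le (hz i)).trans
        (prod_one_sub_le_inv_one_add_sum v hv0 hv1)
  have hR : 2 ^ m * (V / (1 + V)) ≤ ∑ t : Finset ι, (1 - (∏ i ∈ t, z i).re) := by
    rw [Finset.sum_sub_distrib]
    have : V / (1 + V) = 1 - (1 + V)⁻¹ := by field_simp; ring
    rw [this]
    simp only [Finset.sum_const, Finset.card_univ, Fintype.card_finset, nsmul_eq_mul, mul_one]
    push_cast
    change _ ≤ 2 ^ m - _
    linarith
  have hL : ∑ i, (1 - (z i ^ k).re) ≤ 8 * m * (V / (1 + V)) := by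
    rcases le_total V 1 with h | h
    · have : V / 2 ≤ V / (1 + V) := by gcongr; linarith
      have := mul_le_mul_of_nonneg_left this (by positivity : (0:ℝ) ≤ 8 * m)
      linarith
    · have : 1 / 2 ≤ V / (1 + V) := by rw [div_le_div_iff₀] <;> linarith
      have := mul_le_mul_of_nonneg_left this (by positivity : (0:ℝ) ≤ 8 * m)
      have hm : (0:ℝ) ≤ m := by positivity
      linarith
  calc _ ≤ 8 * m * (V / (1 + V)) * 2 ^ m := by gcongr
    _ = 8 * m * (2 ^ m * (V / (1 + V))) := by ring
    _ ≤ _ := by gcongr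
end

section
variable {A : Type*} [AddCommGroup A] [Fintype A]

lemma AddChar.sum_re_apply [DecidableEq A] (g : A) :
    ∑ χ : AddChar A ℂ, (χ g).re = if g = 0 then (Fintype.card A : ℝ) else 0 := by
  rw [← Complex.re_sum, AddChar.sum_apply_eq_ite]
  split_ifs <;> simp

/-- The Fourier expansion of a translation average of a symmetric kernel vanishing
on the diagonal. -/
lemma sum_neg_fourier_mul_one_sub_re (φ : A → ℝ) (h0 : φ 0 = 0) (hs : ∀ g, φ (-g) = φ g) (h : A) :
    ∑ χ : AddChar A ℂ, (-∑ g, φ g * (χ g).re) * (1 - (χ h).re) = Fintype.card A * φ h := by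
  classical
  have hmul : ∀ (χ : AddChar A ℂ) (g : A),
      (χ g).re * (χ h).re = ((χ (g + h)).re + (χ (g - h)).re) / 2 := by
    intro χ g
    rw [sub_eq_add_neg, χ.map_add_eq_mul, χ.map_add_eq_mul, AddChar.map_neg_eq_conj]
    simp
  have h1 : ∀ χ : AddChar A ℂ, (-∑ g, φ g * (χ g).re) * (1 - (χ h).re) =
      ∑ g, φ g * (((χ (g + h)).re + (χ (g - h)).re) / 2 - (χ g).re) := by
    intro χ
    rw [← Finset.sum_neg_distrib, Finset.sum_mul]
    refine Finset.sum_congr rfl fun g _ => ?_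
    rw [← hmul]
    ring
  simp only [h1]
  rw [Finset.sum_comm]
  simp only [← Finset.mul_sum, Finset.sum_sub_distrib, ← Finset.sum_div, Finset.sum_add_distrib,
    AddChar.sum_re_apply, add_eq_zero_iff_eq_neg, sub_eq_zero]
  simp only [mul_sub, mul_div_assoc', mul_add, mul_ite, mul_zero, Finset.sum_sub_distrib,
    ← Finset.sum_div, Finset.sum_add_distrib, Finset.sum_ite_eq', Finset.mem_univ, if_true, hs, h0]
  ring

lemma fourier_nonpos_of_negType (K : A → A → ℝ)
    (hK : ∀ a : A → ℝ, ∑ x, a x = 0 → ∑ x, ∑ y, a x * a y * K x y ≤ 0)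
    {χ : AddChar A ℂ} (hχ : χ ≠ 0) : ∑ g, (∑ x, K x (x + g)) * (χ g).re ≤ 0 := by
  have hsum := AddChar.sum_eq_zero_iff_ne_zero.2 hχ
  have hre := hK (fun x => (χ x).re) (by rw [← Complex.re_sum, hsum, Complex.zero_re])
  have him := hK (fun x => (χ x).im) (by rw [← Complex.im_sum, hsum, Complex.zero_im])
  have : ∑ g, (∑ x, K x (x + g)) * (χ g).re =
      ∑ x, ∑ y, (χ x).re * (χ y).re * K x y + ∑ x, ∑ y, (χ x).im * (χ y).im * K x y := by
    simp only [Finset.sum_mul]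
    rw [Finset.sum_comm, ← Finset.sum_add_distrib]
    refine Finset.sum_congr rfl fun x _ => ?_
    rw [← Finset.sum_add_distrib, ← Equiv.sum_comp (Equiv.addLeft x) fun y =>
      (χ x).re * (χ y).re * K x y + (χ x).im * (χ y).im * K x y]
    refine Finset.sum_congr rfl fun g _ => ?_
    have hg : χ g = χ (x + g) * (starRingEnd ℂ) (χ x) := by
      rw [← AddChar.map_neg_eq_conj, ← χ.map_add_eq_mul]
      congr 1
      abel
    rw [Equiv.coe_addLeft, hg]
    simp
    ring
  linarith

/-- A cotype inequality for kernels of negative type on a finite abelian group. -/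
lemma sum_nsmul_le_of_negType {ι : Type*} [Fintype ι] (K : A → A → ℝ)
    (hK : ∀ a : A → ℝ, ∑ x, a x = 0 → ∑ x, ∑ y, a x * a y * K x y ≤ 0)
    (hs : ∀ x y, K x y = K y x) (h0 : ∀ x, K x x = 0) (e : ι → A) {k : ℕ}
    (hk : k ^ 2 ≤ Fintype.card ι) :
    (∑ i, ∑ x, K x (x + k • e i)) * 2 ^ Fintype.card ι ≤
      8 * Fintype.card ι * ∑ t : Finset ι, ∑ x, K x (x + ∑ i ∈ t, e i) := by
  set φ : A → ℝ := fun g => ∑ x, K x (x + g) with hφ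
  have hφs : ∀ g, φ (-g) = φ g := fun g => by
    simp only [hφ]
    rw [← Equiv.sum_comp (Equiv.addRight g)]
    refine Finset.sum_congr rfl fun x _ => ?_
    rw [Equiv.coe_addRight, hs, add_neg_cancel_right]
  have hφ0 : φ 0 = 0 := by simp [hφ, h0]
  have hF := sum_neg_fourier_mul_one_sub_re φ hφ0 hφs
  have hcard : (0 : ℝ) < Fintype.card A := by exact_mod_cast Fintype.card_pos
  refine le_of_mul_le_mul_left ?_ hcard
  calc (Fintype.card A : ℝ) * ((∑ i, φ (k • e i)) * 2 ^ Fintype.card ι)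
      = (∑ i, (Fintype.card A : ℝ) * φ (k • e i)) * 2 ^ Fintype.card ι := by
        rw [← Finset.mul_sum, mul_assoc]
    _ = ∑ χ : AddChar A ℂ, (-∑ g, φ g * (χ g).re) *
          ((∑ i, (1 - (χ (e i) ^ k).re)) * 2 ^ Fintype.card ι) := by
        simp only [← hF, ← AddChar.map_nsmul_eq_pow]
        rw [Finset.sum_comm, Finset.sum_mul]
        simp only [← Finset.mul_sum, mul_assoc]
    _ ≤ ∑ χ : AddChar A ℂ, (-∑ g, φ g * (χ g).re) *
          (8 * Fintype.card ι * ∑ t : Finset ι, (1 - (∏ i ∈ t, χ (e i)).re)) := by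
        refine Finset.sum_le_sum fun χ _ => ?_
        rcases eq_or_ne χ 0 with rfl | hχ
        · simp
        · exact mul_le_mul_of_nonneg_left
            (sum_one_sub_re_pow_le _ (fun i => χ.norm_apply _) hk)
            (neg_nonneg.2 (fourier_nonpos_of_negType K hK hχ))
    _ = 8 * Fintype.card ι * ∑ t : Finset ι, (Fintype.card A : ℝ) * φ (∑ i ∈ t, e i) := by
        have hprod : ∀ (χ : AddChar A ℂ) (t : Finset ι),
            ∏ i ∈ t, χ (e i) = χ (∑ i ∈ t, e i) := fun χ t => by
          classical
          induction t using Finset.induction_on with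
          | empty => simp
          | insert i t hi ih => rw [Finset.prod_insert hi, Finset.sum_insert hi, ih,
              χ.map_add_eq_mul]
        simp only [← hF, hprod]
        rw [Finset.sum_comm, Finset.mul_sum]
        refine Finset.sum_congr rfl fun χ _ => ?_
        rw [← Finset.mul_sum]
        ring
    _ = _ := by
        rw [← Finset.mul_sum]
        ring
end

open Filter Topology in
lemma negType_of_int {ι : Type*} [Fintype ι] (K : ι → ι → ℝ)
    (hK : ∀ a : ι → ℤ, ∑ i, a i = 0 → ∑ i, ∑ j, (a i : ℝ) * a j * K i j ≤ 0)
    (a : ι → ℝ) (ha : ∑ i, a i = 0) : ∑ i, ∑ j, a i * a j * K i j ≤ 0 := by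
  classical
  rcases isEmpty_or_nonempty ι with h | ⟨⟨i₀⟩⟩
  · simp
  let b : ℕ → ι → ℤ := fun n i =>
    ⌊(n : ℝ) * a i⌋ - if i = i₀ then ∑ j, ⌊(n : ℝ) * a j⌋ else 0
  have hb : ∀ n, ∑ i, b n i = 0 := fun n => by simp [b]
  have hfl : ∀ c : ℝ, Tendsto (fun n : ℕ => (⌊(n : ℝ) * c⌋ : ℝ) / n) atTop (𝓝 c) := by
    intro c
    have h0 : Tendsto (fun n : ℕ => c - 1 / (n : ℝ)) atTop (𝓝 c) := by
      simpa using tendsto_const_nhds.sub (tendsto_one_div_atTop_nhds_zero_nat (𝕜 := ℝ))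
    refine tendsto_of_tendsto_of_tendsto_of_le_of_le' h0 tendsto_const_nhds ?_ ?_ <;>
      filter_upwards [eventually_gt_atTop 0] with n hn
    · have hn' : (0 : ℝ) < n := by exact_mod_cast hn
      rw [le_div_iff₀ hn', sub_mul, one_div_mul_cancel hn'.ne']
      linarith [Int.lt_floor_add_one ((n : ℝ) * c)]
    · have hn' : (0 : ℝ) < n := by exact_mod_cast hn
      rw [div_le_iff₀ hn']
      linarith [Int.floor_le ((n : ℝ) * c)]
  have hlim : ∀ i, Tendsto (fun n : ℕ => (b n i : ℝ) / n) atTop (𝓝 (a i)) := by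
    intro i
    have h1 : Tendsto (fun n : ℕ => ∑ j, (⌊(n : ℝ) * a j⌋ : ℝ) / n) atTop (𝓝 0) := by
      rw [← ha]
      exact tendsto_finsetSum _ fun j _ => hfl (a j)
    by_cases h : i = i₀
    · have := (hfl (a i)).sub h1
      rw [sub_zero] at this
      refine this.congr fun n => ?_
      simp [b, h, sub_div, Finset.sum_div]
    · refine (hfl (a i)).congr fun n => ?_
      simp [b, h]
  refine le_of_tendsto (tendsto_finsetSum _ fun i _ => tendsto_finsetSum _ fun j _ =>
    ((hlim i).mul (hlim j)).mul_const (K i j)) (Eventually.of_forall fun n => ?_)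
  have : ∑ i, ∑ j, (b n i : ℝ) / n * (b n j / n) * K i j =
      (∑ i, ∑ j, (b n i : ℝ) * b n j * K i j) / (n : ℝ) ^ 2 := by
    simp only [Finset.sum_div]
    refine Finset.sum_congr rfl fun i _ => Finset.sum_congr rfl fun j _ => ?_
    ring
  rw [this]
  exact div_nonpos_of_nonpos_of_nonneg (hK _ (hb n)) (by positivity)

lemma exists_fin_sum_eq {ι : Type*} [Fintype ι] (c : ι → ℕ) {n : ℕ} (hn : ∑ i, c i = n) :
    ∃ x : Fin n → ι, ∀ g : ι → ℝ, ∑ u, g (x u) = ∑ i, (c i : ℝ) * g i := by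
  have e : Fin n ≃ Σ i, Fin (c i) := Fintype.equivOfCardEq (by simp [hn])
  refine ⟨fun u => (e u).1, fun g => ?_⟩
  rw [e.sum_comp (fun s => g s.1), Fintype.sum_sigma]
  simp

lemma Fin.sum_sum_ite_lt {n : ℕ} (F : Fin n → Fin n → ℝ) (hs : ∀ i j, F i j = F j i)
    (h0 : ∀ i, F i i = 0) :
    2 * (∑ i, ∑ j, if i < j then F i j else 0) = ∑ i, ∑ j, F i j := by
  have h : ∑ i, ∑ j, (if i < j then F i j else 0) = ∑ i, ∑ j, if j < i then F i j else 0 := by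
    rw [Finset.sum_comm]
    simp only [hs]
  rw [two_mul]
  nth_rewrite 2 [h]
  simp only [← Finset.sum_add_distrib]
  refine Finset.sum_congr rfl fun i _ => Finset.sum_congr rfl fun j _ => ?_
  rcases lt_trichotomy i j with h | rfl | h
  · simp [h, h.not_gt]
  · simp [h0]
  · simp [h, h.not_gt]

/-- A positive exponent in `grSet` makes `dist ^ p` a kernel of negative type. -/
lemma dist_rpow_negType {B : Type*} [MetricSpace B] {p : ℝ}
    (hp : p ∈ grSet (dist : B → B → ℝ)) (hp0 : 0 < p) {ι : Type*} [Fintype ι] (F : ι → B)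
    (a : ι → ℝ) (ha : ∑ i, a i = 0) :
    ∑ i, ∑ j, a i * a j * dist (F i) (F j) ^ p ≤ 0 := by
  refine negType_of_int (fun i j => dist (F i) (F j) ^ p) (fun a ha => ?_) a ha
  set K : ι → ι → ℝ := fun i j => dist (F i) (F j) ^ p with hKdef
  have hKs : ∀ i j, K i j = K j i := fun i j => by simp only [hKdef, dist_comm]
  have hK0 : ∀ i, K i i = 0 := fun i => by simp [hKdef, hp0.ne']
  set c : ι → ℕ := fun i => 2 * (a i).toNat
  set e : ι → ℕ := fun i => 2 * (-a i).toNat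
  have hae : ∀ i, 2 * a i = c i - e i := fun i => by simp only [c, e]; omega
  have hae' : ∀ i, 2 * (a i : ℝ) = c i - e i := fun i => by exact_mod_cast hae i
  have hce : ∑ i, e i = ∑ i, c i := by
    have : ∑ i, ((c i : ℤ) - e i) = 0 := by
      simp only [← hae, ← Finset.mul_sum, ha, mul_zero]
    rw [Finset.sum_sub_distrib, sub_eq_zero] at this
    exact_mod_cast this.symm
  have hexp : 4 * ∑ i, ∑ j, (a i : ℝ) * a j * K i j =
      ∑ i, ∑ j, ((c i : ℝ) - e i) * (c j - e j) * K i j := by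
    simp only [Finset.mul_sum, ← hae']
    refine Finset.sum_congr rfl fun i _ => Finset.sum_congr rfl fun j _ => ?_
    ring
  obtain ⟨x, hx⟩ := exists_fin_sum_eq c rfl
  obtain ⟨y, hy⟩ := exists_fin_sum_eq e hce
  by_cases hn : 2 ≤ ∑ i, c i
  · have h := hp.2 _ hn (F ∘ x) (F ∘ y)
    have h2 := Fin.sum_sum_ite_lt (fun u v => K (x u) (x v) + K (y u) (y v))
      (fun u v => by rw [hKs (x u), hKs (y u)]) (fun u => by simp [hK0])
    change (∑ u, ∑ v, if u < v then K (x u) (x v) + K (y u) (y v) else 0) ≤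
      ∑ u, ∑ v, K (x u) (y v) at h
    simp only [Finset.sum_add_distrib] at h2
    have hxx : ∑ u, ∑ v, K (x u) (x v) = ∑ i, ∑ j, (c i : ℝ) * c j * K i j := by
      simp only [fun i => hx (K i)]
      rw [hx (fun i => ∑ j, (c j : ℝ) * K i j)]
      simp only [Finset.mul_sum, mul_assoc]
    have hyy : ∑ u, ∑ v, K (y u) (y v) = ∑ i, ∑ j, (e i : ℝ) * e j * K i j := by
      simp only [fun i => hy (K i)]
      rw [hy (fun i => ∑ j, (e j : ℝ) * K i j)]
      simp only [Finset.mul_sum, mul_assoc]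
    have hxy : ∑ u, ∑ v, K (x u) (y v) = ∑ i, ∑ j, (c i : ℝ) * e j * K i j := by
      simp only [fun i => hy (K i)]
      rw [hx (fun i => ∑ j, (e j : ℝ) * K i j)]
      simp only [Finset.mul_sum, mul_assoc]
    have hyx : ∑ i, ∑ j, (e i : ℝ) * c j * K i j = ∑ i, ∑ j, (c i : ℝ) * e j * K i j := by
      rw [Finset.sum_comm]
      refine Finset.sum_congr rfl fun i _ => Finset.sum_congr rfl fun j _ => ?_
      rw [hKs]; ring
    simp only [sub_mul, mul_sub, Finset.sum_sub_distrib] at hexp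
    rw [hyx, ← hxx, ← hyy, ← hxy] at hexp
    linarith
  · have hc : ∑ i, c i = 0 := by
      have : ∑ i, c i = 2 * ∑ i, (a i).toNat := by simp only [c, Finset.mul_sum]
      omega
    rw [hc] at hce
    simp only [Finset.sum_eq_zero_iff, Finset.mem_univ, true_imp_iff] at hc hce
    have : ∀ i, (a i : ℝ) = 0 := fun i => by
      have := hae' i
      simp only [hc, hce] at this
      simpa using this
    simp [this]

/-- The distance to zero in the cycle `ZMod n`. -/
def ZMod.cycleNorm {n : ℕ} (v : ZMod n) : ℤ := v.valMinAbs.natAbs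

lemma ZMod.abs_cycleNorm_add_one_sub {n : ℕ} (hn : 1 < n) (v : ZMod n) :
    |(v + 1).cycleNorm - v.cycleNorm| ≤ 1 := by
  have : NeZero n := ⟨by omega⟩
  have h1 : (1 : ZMod n).valMinAbs = 1 :=
    (ZMod.valMinAbs_spec _ _).2 ⟨by simp, by simp; omega⟩
  have hn1 : (-1 : ZMod n).valMinAbs.natAbs = 1 := by rw [ZMod.natAbs_valMinAbs_neg, h1]; rfl
  have ha := ZMod.natAbs_valMinAbs_add_le v 1
  have hb := ZMod.natAbs_valMinAbs_add_le (v + 1) (-1)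
  rw [add_neg_cancel_right] at hb
  unfold cycleNorm
  rw [abs_le]
  omega

lemma ZMod.cycleNorm_antipodal {l : ℕ} (hl : 0 < l) (v : ZMod (4 * l)) :
    (l : ℤ) ≤ |(v + (2 * l : ℕ)).cycleNorm - v.cycleNorm| ∨
      (l : ℤ) ≤ |(v + (l : ℕ) + (2 * l : ℕ)).cycleNorm - (v + (l : ℕ)).cycleNorm| := by
  have : NeZero (4 * l) := ⟨by omega⟩
  obtain ⟨y, hy⟩ : ∃ y, v.valMinAbs = y := ⟨_, rfl⟩
  obtain ⟨rfl, hy1, hy2⟩ := (ZMod.valMinAbs_spec _ _).1 hy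
  push_cast at hy1 hy2
  have hper : ∀ z : ℤ, (z : ZMod (4 * l)) = ((z - 4 * l : ℤ) : ZMod (4 * l)) := by
    intro z
    rw [ZMod.intCast_eq_intCast_iff_dvd_sub]
    exact ⟨-1, by push_cast; ring⟩
  have hnorm : ∀ z : ℤ, -(4 * l) < z * 2 → z * 2 ≤ 12 * l →
      (z : ZMod (4 * l)).cycleNorm = if z * 2 ≤ 4 * l then |z| else |z - 4 * l| := by
    intro z h1 h2
    unfold cycleNorm
    split_ifs with h
    · rw [(ZMod.valMinAbs_spec (z : ZMod (4 * l)) z).2 ⟨rfl, by push_cast; exact h1,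
        by push_cast; exact h⟩, Int.natCast_natAbs]
    · rw [(ZMod.valMinAbs_spec (z : ZMod (4 * l)) (z - 4 * l)).2 ⟨hper z, by push_cast; linarith,
        by push_cast; linarith⟩, Int.natCast_natAbs]
  have e1 : ((y : ZMod (4 * l)) + (2 * l : ℕ)) = ((y + 2 * l : ℤ) : ZMod (4 * l)) := by
    push_cast; ring
  have e2 : ((y : ZMod (4 * l)) + (l : ℕ)) = ((y + l : ℤ) : ZMod (4 * l)) := by push_cast; ring
  have e3 : (((y + l : ℤ) : ZMod (4 * l)) + (2 * l : ℕ)) = ((y + 3 * l : ℤ) : ZMod (4 * l)) := by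
    push_cast; ring
  rw [e1, e2, e3, hnorm _ (by omega) (by omega), hnorm _ (by omega) (by omega),
    hnorm _ (by omega) (by omega), hnorm _ (by omega) (by omega)]
  grind

/-- The nonzero vectors of sup norm one. -/
def supUnitVectors : Set (ℕ →₀ ℤ) := {x | x ≠ 0 ∧ ∀ i, |x i| ≤ 1}

lemma isSymmGenSet_supUnitVectors : IsSymmGenSet supUnitVectors := by
  refine ⟨fun s hs => ⟨neg_ne_zero.2 hs.1, fun i => by simpa using hs.2 i⟩,
    fun h => h.1 rfl, fun x => ?_⟩
  have hx : x ∈ AddSubmonoid.closure supUnitVectors := by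
    have hsingle : ∀ (i : ℕ) (c : ℤ), |c| = 1 → Finsupp.single i c ∈ supUnitVectors := by
      refine fun i c hc => ⟨?_, fun j => ?_⟩
      · rw [Ne, Finsupp.single_eq_zero]
        rintro rfl
        simp at hc
      · rw [Finsupp.single_apply]
        split_ifs <;> simp [hc]
    induction x using Finsupp.induction_linear with
    | zero => exact zero_mem _
    | add f g hf hg => exact add_mem hf hg
    | single i n =>
      obtain ⟨m, rfl | rfl⟩ := n.eq_nat_or_neg
      · have := nsmul_mem (AddSubmonoid.subset_closure (hsingle i 1 (by simp))) m
        simpa using this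
      · have := nsmul_mem (AddSubmonoid.subset_closure (hsingle i (-1) (by simp))) m
        simpa using this
  obtain ⟨L, hL, rfl⟩ := AddSubmonoid.exists_list_of_mem_closure hx
  exact ⟨L.length, fun i => L[i.1], fun i => hL _ (List.getElem_mem _), Fin.sum_univ_getElem L⟩

lemma wordDist_supUnitVectors_le_one {a b : ℕ →₀ ℤ} (h : ∀ i, |b i - a i| ≤ 1) :
    wordDist supUnitVectors a b ≤ 1 := by
  by_cases hab : b - a = 0
  · refine (Nat.sInf_le (m := 0) ?_).trans zero_le_one
    exact ⟨Fin.elim0, fun i => i.elim0, by simp [hab]⟩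
  · exact Nat.sInf_le ⟨fun _ => b - a, fun _ => ⟨hab, fun i => by simpa using h i⟩, by simp⟩

lemma abs_sub_le_wordDist_supUnitVectors (a b : ℕ →₀ ℤ) (i : ℕ) :
    |b i - a i| ≤ wordDist supUnitVectors a b := by
  obtain ⟨w, hw, hsum⟩ : wordDist supUnitVectors a b ∈
      {k : ℕ | ∃ w : Fin k → ℕ →₀ ℤ, (∀ i, w i ∈ supUnitVectors) ∧ ∑ i, w i = b - a} :=
    Nat.sInf_mem (isSymmGenSet_supUnitVectors.2.2 (b - a))
  rw [← Finsupp.sub_apply, ← hsum, Finsupp.finsetSum_apply]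
  refine (Finset.abs_sum_le_sum_abs _ _).trans ?_
  refine (Finset.sum_le_card_nsmul _ _ 1 fun j _ => (hw j).2 i).trans ?_
  simp

/-- The coordinatewise folding of the discrete torus into the integer lattice. -/
noncomputable def foldTorus {n m : ℕ} (x : Fin m → ZMod n) : ℕ →₀ ℤ :=
  Finsupp.onFinset (Finset.range m) (fun j => if h : j < m then (x ⟨j, h⟩).cycleNorm else 0)
    fun j hj => by
      by_contra h
      rw [Finset.mem_range] at h
      simp [h] at hj

lemma foldTorus_apply {n m : ℕ} (x : Fin m → ZMod n) (i : Fin m) :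
    foldTorus x i = (x i).cycleNorm := by
  simp [foldTorus]

lemma wordDist_foldTorus_add_sum_le_one {n m : ℕ} (hn : 1 < n) (x : Fin m → ZMod n)
    (t : Finset (Fin m)) :
    wordDist supUnitVectors (foldTorus x) (foldTorus (x + ∑ i ∈ t, Pi.single i 1)) ≤ 1 := by
  refine wordDist_supUnitVectors_le_one fun j => ?_
  by_cases hj : j < m
  · have := foldTorus_apply x ⟨j, hj⟩
    have h2 := foldTorus_apply (x + ∑ i ∈ t, Pi.single i 1) ⟨j, hj⟩
    simp only at this h2
    rw [this, h2, Pi.add_apply, Finset.sum_apply]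
    simp only [Pi.single_apply, Finset.sum_ite_eq]
    split_ifs
    · exact ZMod.abs_cycleNorm_add_one_sub hn _
    · simp
  · simp [foldTorus, hj]

lemma le_wordDist_foldTorus_antipodal {l m : ℕ} (hl : 0 < l) (x : Fin m → ZMod (4 * l))
    (i : Fin m) :
    let e : Fin m → ZMod (4 * l) := Pi.single i 1
    l ≤ wordDist supUnitVectors (foldTorus x) (foldTorus (x + (2 * l) • e)) ∨
      l ≤ wordDist supUnitVectors (foldTorus (x + l • e))
        (foldTorus (x + l • e + (2 * l) • e)) := by
  intro e
  have hi : ∀ (y : Fin m → ZMod (4 * l)) (c : ℕ), (y + c • e) i = y i + (c : ℕ) := by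
    intro y c
    simp [e]
  refine (ZMod.cycleNorm_antipodal hl (x i)).imp (fun h => ?_) fun h => ?_
  · have := abs_sub_le_wordDist_supUnitVectors (foldTorus x) (foldTorus (x + (2 * l) • e)) i
    rw [foldTorus_apply, foldTorus_apply, hi] at this
    exact_mod_cast h.trans this
  · have := abs_sub_le_wordDist_supUnitVectors (foldTorus (x + l • e))
      (foldTorus (x + l • e + (2 * l) • e)) i
    rw [foldTorus_apply, foldTorus_apply, hi, hi] at this
    exact_mod_cast h.trans this

/-- In a space admitting the roundness exponent `p`, the lower control function of a coarse
embedding of the sup-norm lattice is bounded in terms of the upper one. -/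
lemma rpow_lower_control_le {B : Type*} [MetricSpace B] {p : ℝ}
    (hp : p ∈ grSet (dist : B → B → ℝ)) (hp0 : 0 < p) (f : (ℕ →₀ ℤ) → B) {ρ₁ ρ₂ : ℝ → ℝ}
    (hρ₁ : Monotone ρ₁) (hρ₂ : Monotone ρ₂)
    (hf : ∀ a b, ρ₁ (wordDist supUnitVectors a b) ≤ dist (f a) (f b) ∧
      dist (f a) (f b) ≤ ρ₂ (wordDist supUnitVectors a b))
    {l : ℕ} (hl : 0 < l) (hl0 : 0 ≤ ρ₁ l) : ρ₁ l ^ p ≤ 16 * ρ₂ 1 ^ p := by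
  have : NeZero (4 * l) := ⟨by omega⟩
  set m := (2 * l) ^ 2 with hm
  let K : (Fin m → ZMod (4 * l)) → (Fin m → ZMod (4 * l)) → ℝ :=
    fun x y => dist (f (foldTorus x)) (f (foldTorus y)) ^ p
  have hK0 : ∀ x y, 0 ≤ K x y := fun x y => by positivity
  have hupper : ∀ (t : Finset (Fin m)) x, K x (x + ∑ i ∈ t, Pi.single i 1) ≤ ρ₂ 1 ^ p :=
    fun t x => Real.rpow_le_rpow dist_nonneg ((hf _ _).2.trans (hρ₂ (by
      exact_mod_cast wordDist_foldTorus_add_sum_le_one (by omega) x t))) hp0.le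
  have hpoint : ∀ (i : Fin m) (x : Fin m → ZMod (4 * l)), ρ₁ l ^ p ≤
      K x (x + (2 * l) • Pi.single i 1) +
        K (x + l • Pi.single i 1) (x + l • Pi.single i 1 + (2 * l) • Pi.single i 1) := by
    intro i x
    have hlow : ∀ y z, l ≤ wordDist supUnitVectors (foldTorus y) (foldTorus z) →
        ρ₁ l ^ p ≤ K y z := fun y z h =>
      Real.rpow_le_rpow hl0 ((hρ₁ (by exact_mod_cast h)).trans (hf _ _).1) hp0.le
    rcases le_wordDist_foldTorus_antipodal hl x i with h | h
    · exact (hlow _ _ h).trans (le_add_of_nonneg_right (hK0 _ _))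
    · exact (hlow _ _ h).trans (le_add_of_nonneg_left (hK0 _ _))
  set N : ℝ := (Fintype.card (Fin m → ZMod (4 * l)) : ℝ) with hN
  have hNpos : 0 < N := by rw [hN]; exact_mod_cast Fintype.card_pos
  have hlower : ∀ i : Fin m, N * ρ₁ l ^ p / 2 ≤ ∑ x, K x (x + (2 * l) • Pi.single i 1) := by
    intro i
    have h := Finset.sum_le_sum fun x (_ : x ∈ Finset.univ) => hpoint i x
    rw [Finset.sum_add_distrib] at h
    have h2 := Equiv.sum_comp (Equiv.addRight (l • (Pi.single i 1 : Fin m → ZMod (4 * l))))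
      fun x => K x (x + (2 * l) • Pi.single i 1)
    simp only [Equiv.coe_addRight] at h2
    rw [h2, Finset.sum_const, nsmul_eq_mul, Finset.card_univ, ← hN] at h
    linarith
  have hmain := sum_nsmul_le_of_negType K
    (fun a ha => dist_rpow_negType hp hp0 (fun x => f (foldTorus x)) a ha)
    (fun x y => by simp only [K, dist_comm]) (fun x => by simp [K, hp0.ne'])
    (fun i : Fin m => Pi.single i 1) (k := 2 * l) (by simp [hm])
  rw [Fintype.card_fin] at hmain
  have hL : (m : ℝ) * (N * ρ₁ l ^ p / 2) ≤
      ∑ i : Fin m, ∑ x, K x (x + (2 * l) • Pi.single i 1) := by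
    refine le_trans (le_of_eq ?_) (Finset.sum_le_sum fun i _ => hlower i)
    simp
  have hR : ∑ t : Finset (Fin m), ∑ x, K x (x + ∑ i ∈ t, Pi.single i 1) ≤
      2 ^ m * (N * ρ₂ 1 ^ p) := by
    refine (Finset.sum_le_sum fun t _ => Finset.sum_le_sum fun x _ => hupper t x).trans
      (le_of_eq ?_)
    rw [Finset.sum_const, Finset.sum_const, nsmul_eq_mul, nsmul_eq_mul, Finset.card_univ,
      Finset.card_univ, Fintype.card_finset, Fintype.card_fin, ← hN]
    push_cast
    rfl
  have hm0 : (0 : ℝ) < m := by rw [hm]; positivity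
  have hfin : (m : ℝ) * (N * ρ₁ l ^ p / 2) * 2 ^ m ≤ 8 * m * (2 ^ m * (N * ρ₂ 1 ^ p)) :=
    (mul_le_mul_of_nonneg_right hL (by positivity)).trans
      (hmain.trans (mul_le_mul_of_nonneg_left hR (by positivity)))
  have hpos : 0 < (m : ℝ) * N * 2 ^ m := by positivity
  refine le_of_mul_le_mul_left ?_ hpos
  linarith

/-- Theorem 4 of the paper: there is a symmetric generating set `Σ`
of `ℤ_ω = ⨁_{ℵ₀} ℤ` such that the Cayley graph `Cay(ℤ_ω, Σ)`, with the word metric,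
does not coarsely embed into any metric space of non zero generalized roundness. -/
theorem cayley_graph_not_coarsely_embeddable :
    ∃ S : Set (ℕ →₀ ℤ), IsSymmGenSet S ∧
      ∀ (B : Type*) [MetricSpace B], 0 < genRoundness (dist : B → B → ℝ) →
        ¬∃ f : (ℕ →₀ ℤ) → B,
          IsCoarseEmbeddingWith (fun a b => (wordDist S a b : ℝ)) (dist : B → B → ℝ) f := by
  refine ⟨supUnitVectors, isSymmGenSet_supUnitVectors, ?_⟩
  rintro B _ hB ⟨f, ρ₁, ρ₂, hρ₁, hρ₂, hf, hlim⟩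
  obtain ⟨_, ⟨p, hp, rfl⟩, hp0⟩ := lt_sSup_iff.1 hB
  rw [ENNReal.ofReal_pos] at hp0
  have hlim' := hlim.comp (tendsto_natCast_atTop_atTop (R := ℝ))
  have hlim'' := (tendsto_rpow_atTop hp0).comp hlim'
  obtain ⟨l, hl, hl0, hbig⟩ := ((Filter.eventually_gt_atTop 0).and
    ((hlim'.eventually_ge_atTop 0).and (hlim''.eventually_gt_atTop (16 * ρ₂ 1 ^ p)))).exists
  exact absurd (rpow_lower_control_le hp hp0 f hρ₁ hρ₂ hf hl hl0) (not_le.2 hbig)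
end

section
/- Let (X,d) be a metric space of generalized roundness p = 𝔮(X) with 0 < p < ∞, and let q > p. Define ρ(x,y) = d(x,y)^{p/q}. Then ρ is a metric on X, the metric space (X,ρ) has generalized roundness q, and the identity map on X is both a uniform equivalence and a coarse equivalence between (X,d) and (X,ρ). In particular, for any metric space of positive generalized roundness p there exists a metric space of generalized roundness q > p that is both uniformly and coarsely equivalent to it. -/
theorem mem_grSet_rpow_iff {X : Type*} {d : X → X → ℝ} (hd : ∀ a b, 0 ≤ d a b) {s : ℝ}
    (hs : 0 < s) (r : ℝ) : r ∈ grSet (fun a b => d a b ^ s) ↔ s * r ∈ grSet d := by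
  simp only [grSet, Set.mem_ofPred_eq, ← Real.rpow_mul (hd _ _), mul_nonneg_iff_of_pos_left hs]

theorem genRoundness_rpow {X : Type*} {d : X → X → ℝ} (hd : ∀ a b, 0 ≤ d a b) {s : ℝ}
    (hs : 0 < s) :
    genRoundness (fun a b => d a b ^ s) = ENNReal.ofReal s⁻¹ * genRoundness d := by
  have h : grSet (fun a b => d a b ^ s) = (fun r => s⁻¹ * r) '' grSet d := by
    ext r
    rw [mem_grSet_rpow_iff hd hs]
    constructor
    · exact fun hr => ⟨s * r, hr, inv_mul_cancel_left₀ hs.ne' r⟩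
    · rintro ⟨t, ht, rfl⟩
      simpa [mul_inv_cancel_left₀ hs.ne'] using ht
  simp only [genRoundness, h, Set.image_image, ENNReal.ofReal_mul (inv_pos.2 hs).le,
    sSup_image, ENNReal.mul_iSup]

theorem isUniformEmbeddingWith_rpow {X : Type*} {d : X → X → ℝ} (hd : ∀ a b, 0 ≤ d a b) {s : ℝ}
    (hs : 0 < s) : IsUniformEmbeddingWith d (fun a b => d a b ^ s) (id : X → X) := by
  refine ⟨Function.injective_id, fun ε hε => ⟨ε ^ s⁻¹, Real.rpow_pos_of_pos hε _, fun a b h => ?_⟩,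
    fun ε hε => ⟨ε ^ s, Real.rpow_pos_of_pos hε _, fun a b h => ?_⟩⟩
  · exact (Real.lt_rpow_inv_iff_of_pos (hd a b) hε.le hs).1 h
  · exact (Real.rpow_lt_rpow_iff (hd a b) hε.le hs).1 h

theorem isCoarseEmbeddingWith_rpow {X : Type*} {d : X → X → ℝ} (hd : ∀ a b, 0 ≤ d a b) {s : ℝ}
    (hs : 0 < s) : IsCoarseEmbeddingWith d (fun a b => d a b ^ s) (id : X → X) := by
  have hmono : Monotone fun t : ℝ => max t 0 ^ s := fun t u h =>
    Real.rpow_le_rpow (le_max_right _ _) (max_le_max_right 0 h) hs.le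
  refine ⟨_, _, hmono, hmono, fun a b => by simp [hd a b], ?_⟩
  exact (tendsto_rpow_atTop hs).comp
    (Filter.tendsto_atTop_mono (fun t => le_max_left t 0) Filter.tendsto_id)

/-- Remark 1 of the paper: if `(X,d)` has generalized roundness
`p = 𝔮(X)` with `0 < p < ∞` and `q > p`, then `ρ(x,y) = d(x,y)^{p/q}` is a metric on
`X`, the space `(X,ρ)` has generalized roundness `q`, and the identity map is both a
uniform equivalence and a coarse equivalence between `(X,d)` and `(X,ρ)`. -/
theorem metric_transform_roundness {X : Type*} [MetricSpace X] (p q : ℝ) (hp : 0 < p)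
    (hq : genRoundness (dist : X → X → ℝ) = ENNReal.ofReal p) (hpq : p < q) :
    (∀ x y : X, dist x y ^ (p / q) = 0 ↔ x = y) ∧
    (∀ x y : X, dist x y ^ (p / q) = dist y x ^ (p / q)) ∧
    (∀ x y z : X, dist x z ^ (p / q) ≤ dist x y ^ (p / q) + dist y z ^ (p / q)) ∧
    genRoundness (fun x y : X => dist x y ^ (p / q)) = ENNReal.ofReal q ∧
    IsUniformEmbeddingWith (dist : X → X → ℝ) (fun x y : X => dist x y ^ (p / q))
      (id : X → X) ∧
    IsUniformEmbeddingWith (fun x y : X => dist x y ^ (p / q)) (dist : X → X → ℝ)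
      (id : X → X) ∧
    IsCoarseEmbeddingWith (dist : X → X → ℝ) (fun x y : X => dist x y ^ (p / q))
      (id : X → X) ∧
    IsCoarseEmbeddingWith (fun x y : X => dist x y ^ (p / q)) (dist : X → X → ℝ)
      (id : X → X) := by
  have hq0 : 0 < q := hp.trans hpq
  have hs : 0 < p / q := div_pos hp hq0
  have hd : ∀ a b : X, 0 ≤ dist a b := fun _ _ => dist_nonneg
  have hd' : ∀ a b : X, 0 ≤ dist a b ^ (p / q) := fun a b => Real.rpow_nonneg (hd a b) _
  have hinv : (fun a b : X => (dist a b ^ (p / q)) ^ (p / q)⁻¹) = dist := by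
    ext a b
    exact Real.rpow_rpow_inv (hd a b) hs.ne'
  refine ⟨fun x y => ?_, fun x y => by rw [dist_comm], fun x y z => ?_, ?_,
    isUniformEmbeddingWith_rpow hd hs, ?_, isCoarseEmbeddingWith_rpow hd hs, ?_⟩
  · rw [Real.rpow_eq_zero (hd x y) hs.ne', dist_eq_zero]
  · exact (Real.rpow_le_rpow (hd x z) (dist_triangle x y z) hs.le).trans
      (Real.rpow_add_le_add_rpow (hd x y) (hd y z) hs.le ((div_le_one hq0).2 hpq.le))
  · rw [genRoundness_rpow hd hs, hq, ← ENNReal.ofReal_mul (inv_pos.2 hs).le, inv_div,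
      div_mul_cancel₀ q hp.ne']
  · simpa only [hinv] using isUniformEmbeddingWith_rpow hd' (inv_pos.2 hs)
  · simpa only [hinv] using isCoarseEmbeddingWith_rpow hd' (inv_pos.2 hs)
end

section
/- Let p > 0. Every locally finite metric space (Z,d) admits a uniformly continuous injection into ℓ_p: there exists an injective map f : Z → ℝ^ℕ such that Σ_{n=1}^∞ |f(x)_n − f(y)_n|^p ≤ d(x,y) for all x, y ∈ Z; in particular ‖f(x) − f(y)‖_p ≤ d(x,y)^{1/p}, so f takes values in ℓ_p and is uniformly continuous. -/
/-- A metric space is locally finite if all of its bounded subsets are finite. -/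
def LocallyFiniteSpace (Z : Type*) [MetricSpace Z] : Prop :=
  ∀ s : Set Z, Bornology.IsBounded s → s.Finite

theorem LocallyFiniteSpace.countable {Z : Type*} [MetricSpace Z] (hZ : LocallyFiniteSpace Z) :
    Countable Z := by
  rcases isEmpty_or_nonempty Z with _ | ⟨⟨z⟩⟩
  · infer_instance
  rw [← Set.countable_univ_iff, ← Metric.iUnion_ball_nat z]
  exact Set.countable_iUnion fun n => (hZ _ Metric.isBounded_ball).countable

theorem LocallyFiniteSpace.exists_pos_le_dist {Z : Type*} [MetricSpace Z]
    (hZ : LocallyFiniteSpace Z) (x : Z) : ∃ r > 0, ∀ y, y ≠ x → r ≤ dist x y := by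
  have hfin : (Metric.ball x 1 \ {x}).Finite :=
    (hZ _ Metric.isBounded_ball).subset Set.sdiff_subset
  obtain ⟨ε, hε, h⟩ := Metric.isOpen_iff.1 hfin.isClosed.isOpen_compl x (by simp)
  refine ⟨min ε 1, lt_min hε one_pos, fun y hy => ?_⟩
  by_contra! hlt
  rw [dist_comm, lt_min_iff] at hlt
  exact h (Metric.mem_ball.2 hlt.1) ⟨Metric.mem_ball.2 hlt.2, hy⟩

theorem abs_single_rpow_inv_rpow {p r : ℝ} (hp : 0 < p) (hr : 0 ≤ r) (m n : ℕ) :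
    |(Pi.single m (r ^ p⁻¹) : ℕ → ℝ) n| ^ p = (Pi.single m r : ℕ → ℝ) n := by
  rcases eq_or_ne n m with rfl | h
  · simp [abs_of_nonneg (Real.rpow_nonneg hr _), Real.rpow_inv_rpow hr hp.ne']
  · simp [h, Real.zero_rpow hp.ne']

theorem abs_single_sub_single_rpow {p : ℝ} (hp : 0 < p) {m k : ℕ} (hmk : m ≠ k) (a b : ℝ) (n : ℕ) :
    |(Pi.single m a : ℕ → ℝ) n - (Pi.single k b : ℕ → ℝ) n| ^ p =
      |(Pi.single m a : ℕ → ℝ) n| ^ p + |(Pi.single k b : ℕ → ℝ) n| ^ p := by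
  rcases eq_or_ne n m with rfl | h
  · simp [hmk, Real.zero_rpow hp.ne']
  · simp [h, Real.zero_rpow hp.ne']

/-- Theorem 6 of the paper: for every `p > 0`, every locally finite
metric space `(Z,d)` admits a uniformly continuous injection `f` into `ℓ_p`:
`f` is injective, takes values in `ℓ_p`, and satisfies
`Σ_n |f(x)_n − f(y)_n|^p ≤ d(x,y)` (so `‖f(x) − f(y)‖_p ≤ d(x,y)^{1/p}`). -/
theorem locally_finite_uniformly_injects_into_ell_p (p : ℝ) (hp : 0 < p)
    {Z : Type*} [MetricSpace Z] (hZ : LocallyFiniteSpace Z) :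
    ∃ f : Z → ℕ → ℝ, Function.Injective f ∧
      (∀ x : Z, Summable fun n : ℕ => |f x n| ^ p) ∧
      ∀ x y : Z, Summable (fun n : ℕ => |f x n - f y n| ^ p) ∧
        (∑' n : ℕ, |f x n - f y n| ^ p) ≤ dist x y := by
  have := hZ.countable
  obtain ⟨e, he⟩ := exists_injective_nat Z
  choose r hr hrd using hZ.exists_pos_le_dist
  have hsum (x : Z) :
      HasSum (fun n => |(Pi.single (e x) ((r x / 2) ^ p⁻¹) : ℕ → ℝ) n| ^ p) (r x / 2) := by
    simp_rw [abs_single_rpow_inv_rpow hp (half_pos (hr x)).le]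
    exact hasSum_pi_single _ _
  refine ⟨fun x => Pi.single (e x) ((r x / 2) ^ p⁻¹), fun x y hxy => ?_,
    fun x => (hsum x).summable, fun x y => ?_⟩
  · by_contra hne
    have h := congrFun hxy (e x)
    simp only [Pi.single_eq_same, Pi.single_eq_of_ne (he.ne hne)] at h
    exact (Real.rpow_pos_of_pos (half_pos (hr x)) _).ne' h
  · rcases eq_or_ne x y with rfl | hne
    · simp [Real.zero_rpow hp.ne']
    · simp_rw [abs_single_sub_single_rpow hp (he.ne hne)]
      have h := (hsum x).add (hsum y)
      refine ⟨h.summable, h.tsum_eq.trans_le ?_⟩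
      have hx := hrd x y hne.symm
      have hy := hrd y x hne
      rw [dist_comm] at hy
      linarith
end

section
/- Let (Z,d) be a discrete metric space (for each x ∈ Z there exists δ > 0 such that d(x,y) > δ for all y ≠ x), and let (Y,ρ) be a metric space containing a nested sequence of open balls B_1 ⊇ B_2 ⊇ B_3 ⊇ … such that the diameter t_n of B_n tends to 0 as n → ∞ and the cardinality of Z is at most the cardinality of B_n for every n. Then there exists an injective map f : Z → Y with ρ(f(x), f(y)) ≤ d(x,y) for all x, y ∈ Z (a Lipschitz injection of order 1). -/
universe u v

/-- A family of sets, each of cardinality at least that of the index type, has an injective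
choice function. -/
theorem exists_injective_forall_mem {ι : Type u} {α : Type v} (s : ι → Set α)
    (hs : ∀ i, Cardinal.lift.{v} (Cardinal.mk ι) ≤ Cardinal.lift.{u} (Cardinal.mk (s i))) :
    ∃ f : ι → α, Function.Injective f ∧ ∀ i, f i ∈ s i := by
  obtain ⟨_, _, hord⟩ := Cardinal.exists_ord_eq_type_lt ι
  have step : ∀ (i : ι) (g : ∀ j : ι, j < i → α), ∃ a ∈ s i, ∀ j hj, g j hj ≠ a := by
    intro i g
    by_contra! h
    have hsub : s i ⊆ Set.range fun j : Set.Iio i => g j j.2 := fun a ha =>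
      let ⟨j, hj, hja⟩ := h a ha
      ⟨⟨j, hj⟩, hja⟩
    refine (hs i).not_gt ?_
    calc Cardinal.lift.{u} (Cardinal.mk (s i))
        ≤ Cardinal.lift.{u} (Cardinal.mk (Set.range fun j : Set.Iio i => g j j.2)) :=
          Cardinal.lift_le.2 (Cardinal.mk_le_mk_of_subset hsub)
      _ ≤ Cardinal.lift.{v} (Cardinal.mk (Set.Iio i)) := Cardinal.mk_range_le_lift
      _ < Cardinal.lift.{v} (Cardinal.mk ι) := Cardinal.lift_lt.2 (Cardinal.mk_Iio_lt i hord)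
  choose F hFmem hFne using step
  let f : ι → α := WellFoundedLT.fix F
  have hf : ∀ i, f i = F i fun j _ => f j := WellFoundedLT.fix_eq F
  have hne : ∀ {i j}, j < i → f j ≠ f i := fun {i j} hji => by
    rw [hf i]
    exact hFne i (fun j _ => f j) j hji
  refine ⟨f, fun i j hij => ?_, fun i => ?_⟩
  · by_contra h
    rcases lt_or_gt_of_ne h with h | h
    · exact hne h hij
    · exact hne h hij.symm
  · rw [hf i]
    exact hFmem i _

/-- Theorem 7 of the paper: let `(Z,d)` be a discrete metric space
and let `(Y,ρ)` be a metric space containing a nested sequence of open balls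
`B 0 ⊇ B 1 ⊇ B 2 ⊇ …` whose diameters tend to `0` and with `#Z ≤ #(B n)` for all `n`.
Then there is a Lipschitz injection of order `1` of `Z` into `Y`. -/
theorem discrete_lipschitz_injects {Z : Type u} {Y : Type v}
    [MetricSpace Z] [MetricSpace Y]
    (hdisc : ∀ x : Z, ∃ δ : ℝ, 0 < δ ∧ ∀ y : Z, y ≠ x → δ < dist x y)
    (B : ℕ → Set Y)
    (hball : ∀ n : ℕ, ∃ (c : Y) (r : ℝ), B n = Metric.ball c r)
    (hnested : ∀ n : ℕ, B (n + 1) ⊆ B n)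
    (hdiam : Filter.Tendsto (fun n : ℕ => Metric.diam (B n)) Filter.atTop (nhds 0))
    (hcard : ∀ n : ℕ, Cardinal.lift.{v} (Cardinal.mk Z) ≤
      Cardinal.lift.{u} (Cardinal.mk (B n))) :
    ∃ f : Z → Y, Function.Injective f ∧ ∀ x y : Z, dist (f x) (f y) ≤ dist x y := by
  have hbdd : ∀ n, Bornology.IsBounded (B n) := fun n => by
    obtain ⟨c, r, h⟩ := hball n
    exact h ▸ Metric.isBounded_ball
  choose δ hδpos hδ using hdisc
  choose N hN using fun x => (hdiam.eventually_lt_const (hδpos x)).exists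
  obtain ⟨f, hinj, hmem⟩ := exists_injective_forall_mem (fun x => B (N x)) fun x => hcard (N x)
  have key : ∀ x y, N x ≤ N y → dist (f x) (f y) ≤ dist x y := fun x y hxy => by
    rcases eq_or_ne y x with rfl | hne
    · simp
    · exact ((Metric.dist_le_diam_of_mem (hbdd _) (hmem x)
        (antitone_nat_of_succ_le hnested hxy (hmem y))).trans_lt
          ((hN x).trans (hδ x y hne))).le
  refine ⟨f, hinj, fun x y => ?_⟩
  rcases le_total (N x) (N y) with h | h
  · exact key x y h
  · simpa only [dist_comm] using key y x h
end

section
/- The Banach space c_0 of real sequences converging to zero (with the supremum norm) is neither uniformly nor coarsely embeddable into any metric space of non zero generalized roundness: if (B,d) is a metric space with 𝔮(B) > 0 (including 𝔮(B) = ∞), then there is no uniform embedding and no coarse embedding of c_0 into B. -/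
/-- The Banach space `c₀` of real sequences converging to zero. -/
def cZero : Type := {x : ℕ → ℝ // Filter.Tendsto x Filter.atTop (nhds 0)}

/-- The supremum-norm metric on `c₀`. -/
noncomputable def cZeroDist (x y : cZero) : ℝ := ⨆ n : ℕ, |x.1 n - y.1 n|

/-- The limit of a real sequence along a fixed nonprincipal ultrafilter. -/
noncomputable def ultraLim (F : ℕ → ℝ) : ℝ :=
  Filter.limUnder (Filter.hyperfilter ℕ : Filter ℕ) F

theorem tendsto_ultraLim {F : ℕ → ℝ} {C : ℝ} (hF : ∀ n, |F n| ≤ C) :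
    Filter.Tendsto F (Filter.hyperfilter ℕ : Filter ℕ) (nhds (ultraLim F)) := by
  apply tendsto_nhds_limUnder
  have hK : IsCompact (Set.Icc (-C) C) := isCompact_Icc
  obtain ⟨x, -, hx⟩ := hK.ultrafilter_le_nhds ((Filter.hyperfilter ℕ).map F) (by
    rw [Filter.le_principal_iff]
    exact Filter.mem_map.2 (Filter.Eventually.of_forall fun n => abs_le.1 (hF n)))
  exact ⟨x, hx⟩

theorem abs_ultraLim_le {F : ℕ → ℝ} {C : ℝ} (hF : ∀ n, |F n| ≤ C) : |ultraLim F| ≤ C :=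
  le_of_tendsto (tendsto_ultraLim hF).abs (Filter.Eventually.of_forall hF)

theorem eventually_gt_hyperfilter (M : ℕ) :
    ∀ᶠ n in (Filter.hyperfilter ℕ : Filter ℕ), M < n :=
  Nat.hyperfilter_le_atTop (Filter.eventually_gt_atTop M)

/-- Bounded symmetric kernels, zero on the diagonal, satisfying the generalized roundness
inequality with exponent one. -/
structure IsRoundKernel {X : Type*} (C : ℝ) (K : X → X → ℝ) : Prop where
  bound : ∀ x y, |K x y| ≤ C
  symm : ∀ x y, K x y = K y x
  diag : ∀ x, K x x = 0
  round : ∀ (ι : Type) [Fintype ι], 2 ≤ Fintype.card ι → ∀ x y : ι → X,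
    ∑ i, ∑ j, (K (x i) (x j) + K (y i) (y j)) ≤ ∑ i, ∑ j, 2 * K (x i) (y j)

namespace IsRoundKernel

variable {X Y : Type*} {C : ℝ}

theorem comp {K : X → X → ℝ} (hK : IsRoundKernel C K) (f : Y → X) :
    IsRoundKernel C (fun x y => K (f x) (f y)) :=
  ⟨fun _ _ => hK.bound _ _, fun _ _ => hK.symm _ _, fun _ => hK.diag _,
    fun ι _ h x y => hK.round ι h (fun i => f (x i)) (fun i => f (y i))⟩

theorem ultraLim {K : ℕ → X → X → ℝ} (hK : ∀ n, IsRoundKernel C (K n)) :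
    IsRoundKernel C (fun x y => ultraLim fun n => K n x y) := by
  have ht : ∀ x y, Filter.Tendsto (fun n => K n x y) (Filter.hyperfilter ℕ : Filter ℕ)
      (nhds (_root_.ultraLim fun n => K n x y)) :=
    fun x y => tendsto_ultraLim fun n => (hK n).bound x y
  refine ⟨fun x y => abs_ultraLim_le fun n => (hK n).bound x y, fun x y => ?_, fun x => ?_,
    fun ι _ h x y => ?_⟩
  · simp only [(hK _).symm x y]
  · refine tendsto_nhds_unique (ht x x) ?_
    simp only [(hK _).diag x]
    exact tendsto_const_nhds
  · refine le_of_tendsto_of_tendsto'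
      (tendsto_finsetSum _ fun i _ => tendsto_finsetSum _ fun j _ =>
        (ht (x i) (x j)).add (ht (y i) (y j)))
      (tendsto_finsetSum _ fun i _ => tendsto_finsetSum _ fun j _ =>
        (ht (x i) (y j)).const_mul 2)
      fun n => (hK n).round ι h x y

/-- Along a suitable subsequence, the values of a bounded kernel on two sequences are close
to the iterated limits. -/
theorem exists_seq_close {K : X → X → ℝ} (hK : IsRoundKernel C K) (z : Bool → ℕ → X)
    {ε : ℝ} (hε : 0 < ε) :
    ∃ s : ℕ → ℕ, ∀ m n, m < n → ∀ c c',
      |K (z c (s m)) (z c' (s n)) -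
        _root_.ultraLim fun p => _root_.ultraLim fun q => K (z c p) (z c' q)| < ε := by
  set lam : Bool → Bool → ℝ := fun c c' =>
    _root_.ultraLim fun p => _root_.ultraLim fun q => K (z c p) (z c' q) with hlam
  have hev : ∀ᶠ p in (Filter.hyperfilter ℕ : Filter ℕ), ∀ c c',
      |(_root_.ultraLim fun q => K (z c p) (z c' q)) - lam c c'| < ε := by
    simp only [Filter.eventually_all]
    intro c c'
    have := tendsto_ultraLim (F := fun p => _root_.ultraLim fun q => K (z c p) (z c' q))
      fun p => abs_ultraLim_le fun q => hK.bound _ _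
    exact (Metric.tendsto_nhds.1 this) ε hε
  obtain ⟨s, -, hs⟩ := exists_seq_of_forall_finset_exists
    (fun p => ∀ c c', |(_root_.ultraLim fun q => K (z c p) (z c' q)) - lam c c'| < ε)
    (fun p q => ∀ c c', |K (z c p) (z c' q) - lam c c'| < ε) (by
      intro S hS
      have hS' : ∀ᶠ q in (Filter.hyperfilter ℕ : Filter ℕ), ∀ p ∈ S, ∀ c c',
          |K (z c p) (z c' q) - lam c c'| < ε := by
        rw [Filter.eventually_all_finset]
        intro p hp
        simp only [Filter.eventually_all]
        intro c c'
        have := (tendsto_ultraLim (F := fun q => K (z c p) (z c' q))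
          fun q => hK.bound _ _).sub_const (lam c c')
        exact this.abs.eventually (gt_mem_nhds (hS p hp c c'))
      exact (hev.and hS').exists)
  exact ⟨s, hs⟩

theorem ultraLim_swap_le {K : X → X → ℝ} (hK : IsRoundKernel C K) (u v : ℕ → X) :
    (_root_.ultraLim fun p => _root_.ultraLim fun q => K (u p) (v q)) ≤
      _root_.ultraLim fun q => _root_.ultraLim fun p => K (v q) (u p) := by
  set z : Bool → ℕ → X := fun c => if c then u else v with hz
  set lam : Bool → Bool → ℝ := fun c c' =>
    _root_.ultraLim fun p => _root_.ultraLim fun q => K (z c p) (z c' q) with hlam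
  change lam true false ≤ lam false true
  have hC : 0 ≤ C := (abs_nonneg _).trans (hK.bound (u 0) (u 0))
  have hlamC : ∀ c c', lam c c' ≤ C := fun c c' =>
    (le_abs_self _).trans (abs_ultraLim_le fun p => abs_ultraLim_le fun q => hK.bound _ _)
  refine le_of_forall_pos_le_add fun e he => ?_
  obtain ⟨n, hn⟩ := exists_nat_gt (max 1 (4 * C / e))
  have hn1 : (1 : ℝ) < n := (le_max_left _ _).trans_lt hn
  have hn1' : 1 < n := by exact_mod_cast hn1
  have hnC : 4 * C < n * e := (div_lt_iff₀ he).1 ((le_max_right _ _).trans_lt hn)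
  obtain ⟨ε, hε, hεe⟩ : ∃ ε : ℝ, 0 < ε ∧ 16 * ε = e := ⟨e / 16, by positivity, by ring⟩
  obtain ⟨s, hs⟩ := hK.exists_seq_close z hε
  have hlo : ∀ m n, m < n → ∀ c c', lam c c' - ε ≤ K (z c (s m)) (z c' (s n)) :=
    fun m n h c c' => by linarith [(abs_lt.1 (hs m n h c c')).1]
  have hhi : ∀ m n, m < n → ∀ c c', K (z c (s m)) (z c' (s n)) ≤ lam c c' + ε :=
    fun m n h c c' => by linarith [(abs_lt.1 (hs m n h c c')).2]
  have hsame : ∀ (N : ℕ) (c : Bool) (i j : Fin n),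
      lam c c - ε - (if i = j then C else 0) ≤ K (z c (s (N + i))) (z c (s (N + j))) := by
    intro N c i j
    rcases lt_trichotomy i j with h | h | h
    · rw [if_neg h.ne]
      linarith [hlo (N + i) (N + j) (by simpa using h) c c]
    · subst h
      rw [if_pos rfl, hK.diag]
      linarith [hlamC c c]
    · rw [if_neg h.ne', hK.symm]
      linarith [hlo (N + j) (N + i) (by simpa using h) c c]
  have hround := hK.round (Bool × Fin n) (by simp; omega)
    (fun i => z i.1 (s ((if i.1 then 0 else n) + i.2)))
    (fun i => z i.1 (s ((if i.1 then 2 * n else 3 * n) + i.2)))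
  simp only [Fintype.sum_prod_type, Fintype.sum_bool, if_true, Bool.false_eq_true, if_false,
    ← Finset.sum_add_distrib] at hround
  have hleft : ∑ i : Fin n, ∑ j : Fin n, (2 * lam true true + 2 * lam false false +
        4 * lam true false - 8 * ε - (if i = j then 4 * C else 0)) ≤
      ∑ i : Fin n, ∑ j : Fin n, (2 * lam true true + 2 * lam false false +
        2 * lam true false + 2 * lam false true + 8 * ε) := by
    refine le_trans ?_ (hround.trans ?_)
    · refine Finset.sum_le_sum fun i _ => ?_
      refine Finset.sum_le_sum fun j _ => ?_
      have hi := i.2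
      have hj := j.2
      have h1 := hsame 0 true i j
      have h2 := hsame n false i j
      have h3 := hsame (2 * n) true i j
      have h4 := hsame (3 * n) false i j
      have h5 := hlo (0 + i) (n + j) (by omega) true false
      have h6 := hlo (0 + j) (n + i) (by omega) true false
      have h7 := hlo (2 * n + i) (3 * n + j) (by omega) true false
      have h8 := hlo (2 * n + j) (3 * n + i) (by omega) true false
      rw [hK.symm] at h6 h8
      split_ifs at * <;> linarith
    · refine Finset.sum_le_sum fun i _ => ?_
      refine Finset.sum_le_sum fun j _ => ?_
      have hi := i.2
      have hj := j.2
      have h1 := hhi (0 + i) (2 * n + j) (by omega) true true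
      have h2 := hhi (0 + i) (3 * n + j) (by omega) true false
      have h3 := hhi (n + i) (2 * n + j) (by omega) false true
      have h4 := hhi (n + i) (3 * n + j) (by omega) false false
      linarith
  simp only [Finset.sum_sub_distrib, Finset.sum_const, Finset.card_univ, Fintype.card_fin,
    Finset.sum_ite_eq, Finset.mem_univ, if_true, nsmul_eq_mul] at hleft
  have hpos : (0 : ℝ) < n := by linarith
  have h : n * (2 * lam true false - 2 * lam false true - 16 * ε) ≤ 4 * C := by
    refine le_of_mul_le_mul_left ?_ hpos
    linarith
  have h' : 2 * lam true false - 2 * lam false true - 16 * ε < e :=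
    lt_of_mul_lt_mul_left (h.trans_lt hnC) hpos.le
  linarith

end IsRoundKernel

/-- The iterated ultralimit of `F`, the word telling which argument receives each successive
variable. -/
noncomputable def wordLim : List Bool → (List ℕ → List ℕ → ℝ) → ℝ
  | [], F => F [] []
  | true :: w, F => ultraLim fun n => wordLim w fun a b => F (n :: a) b
  | false :: w, F => ultraLim fun n => wordLim w fun a b => F a (n :: b)

theorem IsRoundKernel.wordLim {X : Type*} {C : ℝ} (w : List Bool)
    {K : List ℕ → List ℕ → X → X → ℝ} (hK : ∀ a b, IsRoundKernel C (K a b)) :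
    IsRoundKernel C (fun x y => wordLim w fun a b => K a b x y) := by
  induction w generalizing K with
  | nil => exact hK [] []
  | cons c w ih =>
    cases c
    · exact IsRoundKernel.ultraLim fun n => ih fun a b => hK a (n :: b)
    · exact IsRoundKernel.ultraLim fun n => ih fun a b => hK (n :: a) b

theorem abs_wordLim_le {C : ℝ} (w : List Bool) {F : List ℕ → List ℕ → ℝ}
    (hF : ∀ a b, |F a b| ≤ C) : |wordLim w F| ≤ C := by
  induction w generalizing F with
  | nil => exact hF [] []
  | cons c w ih =>
    cases c
    · exact abs_ultraLim_le fun n => ih fun a b => hF a (n :: b)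
    · exact abs_ultraLim_le fun n => ih fun a b => hF (n :: a) b

theorem wordLim_swap {X : Type*} {C : ℝ} {K : X → X → ℝ} (hK : IsRoundKernel C K)
    (w : List Bool) (f g : List ℕ → X) :
    wordLim (true :: false :: w) (fun a b => K (f a) (g b)) =
      wordLim (false :: true :: w) (fun a b => K (f a) (g b)) := by
  have hH : IsRoundKernel C (fun x y : Bool × ℕ => wordLim w fun a b =>
      K (if x.1 then f (x.2 :: a) else g (x.2 :: b))
        (if y.1 then f (y.2 :: a) else g (y.2 :: b))) :=
    IsRoundKernel.wordLim w fun a b => hK.comp _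
  have h₁ := hH.ultraLim_swap_le (fun p => (true, p)) (fun q => (false, q))
  have h₂ := hH.ultraLim_swap_le (fun q => (false, q)) (fun p => (true, p))
  have h := le_antisymm h₁ h₂
  simp only [if_true, Bool.false_eq_true, if_false] at h
  simp only [wordLim]
  rw [h]
  simp only [hK.symm (g _) (f _)]

theorem wordLim_perm {X : Type*} {C : ℝ} {K : X → X → ℝ} (hK : IsRoundKernel C K)
    {w w' : List Bool} (h : w.Perm w') (f g : List ℕ → X) :
    wordLim w (fun a b => K (f a) (g b)) = wordLim w' (fun a b => K (f a) (g b)) := by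
  induction h generalizing f g with
  | nil => rfl
  | cons c _ ih =>
    cases c
    · simp only [wordLim]
      exact congrArg ultraLim (funext fun n => ih f fun b => g (n :: b))
    · simp only [wordLim]
      exact congrArg ultraLim (funext fun n => ih (fun a => f (n :: a)) g)
  | swap c c' w =>
    cases c <;> cases c'
    · rfl
    · exact wordLim_swap hK w f g
    · exact (wordLim_swap hK w f g).symm
    · rfl
  | trans _ _ ih₁ ih₂ => exact (ih₁ f g).trans (ih₂ f g)

/-- `Splits M w a b`: the lists `a` and `b` are obtained by distributing an increasing list of
integers larger than `M` according to the word `w`. -/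
def Splits : ℕ → List Bool → List ℕ → List ℕ → Prop
  | _, [], a, b => a = [] ∧ b = []
  | M, true :: w, a, b => ∃ n a', M < n ∧ a = n :: a' ∧ Splits n w a' b
  | M, false :: w, a, b => ∃ n b', M < n ∧ b = n :: b' ∧ Splits n w a b'

theorem wordLim_mem_of_splits {C : ℝ} {S : Set ℝ} (hS : IsClosed S) (w : List Bool) (M : ℕ)
    {F : List ℕ → List ℕ → ℝ} (hF : ∀ a b, |F a b| ≤ C)
    (h : ∀ a b, Splits M w a b → F a b ∈ S) : wordLim w F ∈ S := by
  induction w generalizing M F with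
  | nil => exact h [] [] ⟨rfl, rfl⟩
  | cons c w ih =>
    cases c
    · refine hS.mem_of_tendsto
        (tendsto_ultraLim fun n => abs_wordLim_le w fun a b => hF a (n :: b)) ?_
      filter_upwards [eventually_gt_hyperfilter M] with n hn
      exact ih n (fun a b => hF a (n :: b)) fun a b hab => h a (n :: b) ⟨n, b, hn, rfl, hab⟩
    · refine hS.mem_of_tendsto
        (tendsto_ultraLim fun n => abs_wordLim_le w fun a b => hF (n :: a) b) ?_
      filter_upwards [eventually_gt_hyperfilter M] with n hn
      exact ih n (fun a b => hF (n :: a) b) fun a b hab => h (n :: a) b ⟨n, a, hn, rfl, hab⟩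

/-- The alternating word of length `2 * k`. -/
def alternatingWord : ℕ → List Bool
  | 0 => []
  | k + 1 => true :: false :: alternatingWord k

theorem alternatingWord_perm (k : ℕ) :
    (alternatingWord k).Perm (List.replicate k true ++ List.replicate k false) := by
  induction k with
  | zero => rfl
  | succ k ih =>
    simp only [alternatingWord, List.replicate_succ, List.cons_append]
    exact ((ih.cons false).trans List.perm_middle.symm).cons true

theorem countP_of_splits_alternatingWord (k : ℕ) {M : ℕ} {a b : List ℕ}
    (h : Splits M (alternatingWord k) a b) (t : ℕ) :
    a.countP (t < ·) ≤ b.countP (t < ·) ∧ b.countP (t < ·) ≤ a.countP (t < ·) + 1 ∧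
      (t < M → a.countP (t < ·) = b.countP (t < ·)) := by
  induction k generalizing M a b with
  | zero =>
    obtain ⟨rfl, rfl⟩ := h
    simp
  | succ k ih =>
    obtain ⟨p, a', hp, rfl, q, b', hq, rfl, h⟩ := h
    have := ih h
    simp only [List.countP_cons, decide_eq_true_eq]
    split_ifs <;> omega

theorem exists_countP_of_splits_blocks (j k : ℕ) {M : ℕ} {a b : List ℕ}
    (h : Splits M (List.replicate j true ++ List.replicate k false) a b) :
    ∃ t, M ≤ t ∧ a.countP (t < ·) = 0 ∧ b.countP (t < ·) = k := by
  induction j generalizing M a with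
  | zero =>
    suffices ∀ N ≤ M, a.countP (N < ·) = 0 ∧ b.countP (N < ·) = k from
      ⟨M, le_rfl, this M le_rfl⟩
    simp only [List.replicate_zero, List.nil_append] at h
    intro N hN
    induction k generalizing M b with
    | zero =>
      obtain ⟨rfl, rfl⟩ := h
      simp
    | succ k ih =>
      obtain ⟨q, b', hq, rfl, h⟩ := h
      have := ih h (by omega)
      simp only [List.countP_cons, decide_eq_true_eq]
      split_ifs <;> omega
  | succ j ih =>
    obtain ⟨p, a', hp, rfl, h⟩ := h
    obtain ⟨t, hpt, ha, hb⟩ := ih h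
    refine ⟨t, by omega, ?_, hb⟩
    simp only [List.countP_cons, decide_eq_true_eq]
    split_ifs <;> omega

/-- The sequence `η • ∑ i ∈ a, 1_{[0, i)}`, truncated at height `k * η`. -/
noncomputable def stepSeq (η : ℝ) (k : ℕ) (a : List ℕ) : cZero :=
  ⟨fun t => η * (min k (a.countP (t < ·)) : ℕ), by
    refine tendsto_const_nhds.congr' ?_
    filter_upwards [Filter.eventually_ge_atTop a.sum] with t ht
    have : a.countP (t < ·) = 0 := by
      rw [List.countP_eq_zero]
      intro x hx
      have := List.single_le_sum (by simp) x hx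
      simp only [decide_eq_true_eq]
      omega
    simp [this]⟩

theorem cZeroDist_stepSeq_le {η : ℝ} (hη : 0 ≤ η) {k l m : ℕ} {a b : List ℕ}
    (h : ∀ t, min k (a.countP (t < ·)) ≤ min l (b.countP (t < ·)) + m ∧
      min l (b.countP (t < ·)) ≤ min k (a.countP (t < ·)) + m) :
    ∀ t, |(stepSeq η k a).1 t - (stepSeq η l b).1 t| ≤ η * m := by
  intro t
  simp only [stepSeq, ← mul_sub, abs_mul, abs_of_nonneg hη]
  refine mul_le_mul_of_nonneg_left (abs_sub_le_iff.2 ⟨?_, ?_⟩) hη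
  · rw [sub_le_iff_le_add']
    exact_mod_cast (h t).1
  · rw [sub_le_iff_le_add']
    exact_mod_cast (h t).2

theorem isRoundKernel_of_mem_grSet {X B : Type*} [MetricSpace B] {p C : ℝ} (hp : 0 < p)
    (h : p ∈ grSet (dist : B → B → ℝ)) (f : X → B) (hf : ∀ x y, dist (f x) (f y) ≤ C) :
    IsRoundKernel (C ^ p) (fun x y => dist (f x) (f y) ^ p) := by
  refine ⟨fun x y => ?_, fun x y => by rw [dist_comm], fun x => ?_, fun ι _ hι x y => ?_⟩
  · rw [abs_of_nonneg (by positivity)]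
    exact Real.rpow_le_rpow dist_nonneg (hf x y) hp.le
  · rw [dist_self, Real.zero_rpow hp.ne']
  · have key : ∀ (n : ℕ) (S : Fin n → Fin n → ℝ), (∀ i j, S i j = S j i) → (∀ i, S i i = 0) →
        ∑ i, ∑ j, S i j = 2 * ∑ i, ∑ j, if i < j then S i j else 0 := by
      intro n S hs hd
      rw [two_mul]
      nth_rewrite 3 [Finset.sum_comm]
      simp only [← Finset.sum_add_distrib]
      refine Finset.sum_congr rfl fun i _ => Finset.sum_congr rfl fun j _ => ?_
      rcases lt_trichotomy i j with hij | rfl | hij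
      · simp [hij, hij.not_gt]
      · simp [hd]
      · simp [hij, hij.not_gt, hs i j]
    let e := (Fintype.equivFin ι).symm
    have hr := h.2 _ hι (fun i => f (x (e i))) (fun i => f (y (e i)))
    rw [← e.sum_comp, ← e.sum_comp]
    simp only [← e.sum_comp (fun j => dist (f (x _)) (f (x j)) ^ p +
      dist (f (y _)) (f (y j)) ^ p), ← e.sum_comp (fun j => 2 * dist (f (x _)) (f (y j)) ^ p)]
    rw [key _ (fun i j => dist (f (x (e i))) (f (x (e j))) ^ p +
      dist (f (y (e i))) (f (y (e j))) ^ p)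
      (fun i j => by simp only [dist_comm]) (fun i => by simp [Real.zero_rpow hp.ne'])]
    simp only [← Finset.mul_sum]
    linarith

/-- If `f` moves points of `c₀` at distance at most `η` to points at distance at most `s`, then
some points at distance at least `k * η` are sent to points at distance almost at most `s`. -/
theorem exists_far_dist_lt {B : Type*} [MetricSpace B]
    (hB : 0 < genRoundness (dist : B → B → ℝ)) (f : cZero → B) {η s s' : ℝ} (hη : 0 ≤ η)
    (hs : 0 ≤ s) (hss' : s < s') (hf : ∀ x y, cZeroDist x y ≤ η → dist (f x) (f y) ≤ s)
    (k : ℕ) : ∃ x y, k * η ≤ cZeroDist x y ∧ dist (f x) (f y) < s' := by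
  obtain ⟨_, ⟨p, hp, rfl⟩, hp0⟩ := lt_sSup_iff.1 hB
  replace hp0 : 0 < p := ENNReal.ofReal_pos.1 hp0
  by_contra! hfar
  have hstep : ∀ l (a : List ℕ), dist (f (stepSeq η l a)) (f (stepSeq η 0 [])) ≤ l * s := by
    intro l a
    induction l with
    | zero =>
      have : stepSeq η 0 a = stepSeq η 0 [] := Subtype.ext (by simp [stepSeq])
      simp [this]
    | succ l ih =>
      refine (dist_triangle _ (f (stepSeq η l a)) _).trans ?_
      have : dist (f (stepSeq η (l + 1) a)) (f (stepSeq η l a)) ≤ s := by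
        refine hf _ _ (ciSup_le fun t => ?_)
        simpa using cZeroDist_stepSeq_le hη (m := 1) (fun t => by omega) t
      push_cast
      linarith
  have hK := isRoundKernel_of_mem_grSet hp0 hp (fun a => f (stepSeq η k a))
    (C := k * s + k * s) fun a b => (dist_triangle_right _ _ (f (stepSeq η 0 []))).trans
      (add_le_add (hstep k a) (hstep k b))
  have hnear := wordLim_mem_of_splits (isClosed_Iic (a := s ^ p)) (alternatingWord k) 0
    hK.bound fun a b hab => by
      refine Real.rpow_le_rpow dist_nonneg (hf _ _ (ciSup_le fun t => ?_)) hp0.le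
      simpa using cZeroDist_stepSeq_le hη (m := 1) (fun t => by
        have := countP_of_splits_alternatingWord k hab t
        omega) t
  have hlarge := wordLim_mem_of_splits (isClosed_Ici (a := s' ^ p))
    (List.replicate k true ++ List.replicate k false) 0 hK.bound fun a b hab => by
      refine Real.rpow_le_rpow (hs.trans hss'.le) (hfar _ _ ?_) hp0.le
      obtain ⟨t, -, ha, hb⟩ := exists_countP_of_splits_blocks k k hab
      have hle : |(stepSeq η k a).1 t - (stepSeq η k b).1 t| ≤ _ :=
        le_ciSup (f := fun t => |(stepSeq η k a).1 t - (stepSeq η k b).1 t|)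
          ⟨η * k, by
            rintro _ ⟨t, rfl⟩
            exact cZeroDist_stepSeq_le hη (fun t => by omega) t⟩ t
      refine le_trans ?_ hle
      simp [stepSeq, ha, hb, abs_of_nonneg hη, mul_comm]
  have heq := wordLim_perm hK (alternatingWord_perm k) id id
  simp only [id] at heq
  rw [heq] at hnear
  exact absurd (hlarge.trans hnear) (not_le.2 (Real.rpow_lt_rpow hs hss' hp0))

/-- Corollary 2 of the paper: the Banach space `c₀` is neither
uniformly nor coarsely embeddable into any metric space of non zero generalized
roundness. -/
theorem cZero_not_embeddable {B : Type*} [MetricSpace B]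
    (hB : 0 < genRoundness (dist : B → B → ℝ)) :
    (¬∃ f : cZero → B, IsUniformEmbeddingWith cZeroDist (dist : B → B → ℝ) f) ∧
    (¬∃ f : cZero → B, IsCoarseEmbeddingWith cZeroDist (dist : B → B → ℝ) f) := by
  constructor
  · rintro ⟨f, -, hf, hf'⟩
    obtain ⟨δ', hδ', h'⟩ := hf' 1 one_pos
    obtain ⟨δ, hδ, h⟩ := hf (δ' / 2) (by positivity)
    obtain ⟨k, hk⟩ := exists_nat_one_div_lt hδ
    obtain ⟨x, y, hxy, hlt⟩ := exists_far_dist_lt hB f (η := 1 / ((k : ℝ) + 1)) (by positivity)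
      (by positivity) (half_lt_self hδ') (fun x y hxy => (h x y (hxy.trans_lt hk)).le) (k + 1)
    have := h' x y hlt
    rw [Nat.cast_add_one, mul_one_div_cancel (by positivity)] at hxy
    linarith
  · rintro ⟨f, ρ₁, ρ₂, h₁, h₂, h, hlim⟩
    have hnear : ∀ x y, cZeroDist x y ≤ 1 → dist (f x) (f y) ≤ |ρ₂ 1| := fun x y hxy =>
      ((h x y).2.trans (h₂ hxy)).trans (le_abs_self _)
    obtain ⟨k, hk⟩ := ((hlim.comp tendsto_natCast_atTop_atTop).eventually_ge_atTop
      (|ρ₂ 1| + 1)).exists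
    obtain ⟨x, y, hxy, hlt⟩ := exists_far_dist_lt hB f zero_le_one (abs_nonneg _)
      (lt_add_one |ρ₂ 1|) hnear k
    rw [mul_one] at hxy
    have := (h₁ hxy).trans (h x y).1
    simp only [Function.comp_apply] at hk
    linarith
end

section
/- Let (Y,ς) be a metric space that is Lipschitz universal for all locally finite metric spaces, i.e. every locally finite metric space admits a Lipschitz embedding into Y. Then Y is neither uniformly nor coarsely embeddable into any metric space of non zero generalized roundness: if (B,d) is a metric space with 𝔮(B) > 0 (including 𝔮(B) = ∞), there is no uniform embedding and no coarse embedding of Y into B. -/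
/-- `f` is a Lipschitz embedding of the space with distance function `dX` into the
space with distance function `dY`: `f` is injective and both `f` and `f⁻¹` (on the
range of `f`) are Lipschitz maps of order `1`. -/
def IsLipschitzEmbeddingWith {X Y : Type*} (dX : X → X → ℝ) (dY : Y → Y → ℝ)
    (f : X → Y) : Prop :=
  Function.Injective f ∧ ∃ C₁ C₂ : ℝ, 0 < C₁ ∧
    ∀ a b, C₁ * dX a b ≤ dY (f a) (f b) ∧ dY (f a) (f b) ≤ C₂ * dX a b

/-- A positive exponent in `grSet` gives the roundness inequality in its symmetric form, for
families indexed by any finite type. -/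
theorem grSet.sum_le {B : Type*} [MetricSpace B] {p : ℝ} (hp : 0 < p)
    (h : p ∈ grSet (dist : B → B → ℝ)) {I : Type*} [Fintype I] (hI : 2 ≤ Fintype.card I)
    (x y : I → B) :
    ∑ i, ∑ j, (dist (x i) (x j) ^ p + dist (y i) (y j) ^ p) ≤
      2 * ∑ i, ∑ j, dist (x i) (y j) ^ p := by
  let e := (Fintype.equivFin I).symm
  have key := h.2 _ hI (x ∘ e) (y ∘ e)
  rw [← e.sum_comp, ← e.sum_comp (fun i => ∑ j, dist (x i) (y j) ^ p)]
  simp_rw [← e.sum_comp (fun j => dist (x _) (x j) ^ p + dist (y _) (y j) ^ p),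
    ← e.sum_comp (fun j => dist (x _) (y j) ^ p)]
  simp only [Function.comp_apply] at key
  refine le_trans (le_of_eq ?_) (mul_le_mul_of_nonneg_left key zero_le_two)
  rw [two_mul]
  nth_rewrite 3 [Finset.sum_comm]
  simp_rw [← Finset.sum_add_distrib]
  refine Finset.sum_congr rfl fun i _ => Finset.sum_congr rfl fun j _ => ?_
  rcases lt_trichotomy i j with hij | rfl | hij
  · simp [hij, hij.not_gt]
  · simp [Real.zero_rpow hp.ne']
  · simp [hij, hij.not_gt, dist_comm]

/-- The step of the random walk: the difference of two signs, or zero. -/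
def stepVal (w : Bool × ℤˣ × ℤˣ) : ℤ := if w.1 then (w.2.2 : ℤ) - w.2.1 else 0

section Averages

variable {ι : Type*} [Fintype ι] [DecidableEq ι]

/-- Average of `F` over the random coordinatewise multiples of `u` by steps. -/
noncomputable def stepAvg (F : (ι → ℤ) → ℝ) (u : ι → ℤ) : ℝ :=
  (8 ^ Fintype.card ι)⁻¹ * ∑ w : ι → Bool × ℤˣ × ℤˣ, F (fun i => u i * stepVal (w i))

/-- Average of `F` over the random coordinatewise changes of sign of `u`. -/
noncomputable def signAvg (F : (ι → ℤ) → ℝ) (u : ι → ℤ) : ℝ :=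
  (2 ^ Fintype.card ι)⁻¹ * ∑ e : ι → ℤˣ, F (fun i => u i * e i)

theorem stepAvg_mono {F F' : (ι → ℤ) → ℝ} (h : ∀ u, F u ≤ F' u) (u : ι → ℤ) :
    stepAvg F u ≤ stepAvg F' u :=
  mul_le_mul_of_nonneg_left (Finset.sum_le_sum fun _ _ => h _) (by positivity)

theorem card_signs : Fintype.card (ι → ℤˣ) = 2 ^ Fintype.card ι := by
  simp [Fintype.card_pi]

theorem card_steps : Fintype.card (ι → Bool × ℤˣ × ℤˣ) = 8 ^ Fintype.card ι := by
  simp [Fintype.card_pi]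

theorem sum_step_mul_sign (F : (ι → ℤ) → ℝ) (u : ι → ℤ) (e : ι → ℤˣ) :
    ∑ w : ι → Bool × ℤˣ × ℤˣ, F (fun i => u i * stepVal (w i) * e i) =
      ∑ w : ι → Bool × ℤˣ × ℤˣ, F (fun i => u i * stepVal (w i)) := by
  let φ : (ι → Bool × ℤˣ × ℤˣ) → (ι → Bool × ℤˣ × ℤˣ) :=
    fun w i => ((w i).1, (w i).2.1 * e i, (w i).2.2 * e i)
  have hφ : Function.Involutive φ := by
    intro w
    funext i
    simp [φ, mul_assoc]
  symm
  rw [← Equiv.sum_comp (hφ.toPerm φ)]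
  refine Finset.sum_congr rfl fun w _ => congrArg F (funext fun i => ?_)
  simp only [Function.Involutive.coe_toPerm, φ, stepVal, Units.val_mul]
  by_cases h : (w i).1
  · simp only [h, if_true]
    ring
  · simp [h]

theorem stepAvg_signAvg (F : (ι → ℤ) → ℝ) (u : ι → ℤ) :
    stepAvg (signAvg F) u = stepAvg F u := by
  unfold stepAvg signAvg
  rw [← Finset.mul_sum, Finset.sum_comm]
  simp_rw [sum_step_mul_sign F u]
  rw [Finset.sum_const, Finset.card_univ, card_signs, nsmul_eq_mul]
  push_cast
  field_simp

/-- The translation invariant form of the roundness inequality. -/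
def IsNegType (F : (ι → ℤ) → ℝ) : Prop :=
  ∀ a b : (ι → ℤˣ) → ι → ℤ,
    ∑ i, ∑ j, (F (a j - a i) + F (b j - b i)) ≤ 2 * ∑ i, ∑ j, F (b j - a i)

theorem sum_mixed_signs (F : (ι → ℤ) → ℝ) (u : ι → ℤ) (b : ι → Bool) :
    ∑ e : ι → ℤˣ, ∑ e' : ι → ℤˣ,
      F (fun i => (if b i then 0 else u i * e' i) - if b i then u i * e i else 0) =
      2 ^ Fintype.card ι * ∑ e : ι → ℤˣ, F (fun i => u i * e i) := by
  let φ : (ι → ℤˣ) × (ι → ℤˣ) → (ι → ℤˣ) × (ι → ℤˣ) := fun s =>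
    (fun i => if b i then -s.1 i else s.2 i, fun i => if b i then s.2 i else s.1 i)
  have hφ : Function.Involutive φ := by
    rintro ⟨s, t⟩
    refine Prod.ext (funext fun i => ?_) (funext fun i => ?_) <;>
      by_cases h : b i <;> simp [φ, h]
  rw [← Fintype.sum_prod_type', ← Equiv.sum_comp (hφ.toPerm φ)]
  rw [Fintype.sum_prod_type, Finset.mul_sum]
  refine Finset.sum_congr rfl fun s _ => ?_
  have : ∀ t : ι → ℤˣ, F (fun i => (if b i then 0 else u i * ((φ (s, t)).2 i : ℤ)) -
      if b i then u i * ((φ (s, t)).1 i : ℤ) else 0) = F (fun i => u i * s i) := by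
    intro t
    refine congrArg F (funext fun i => ?_)
    by_cases h : b i <;> simp [φ, h]
  simp only [Function.Involutive.coe_toPerm]
  simp_rw [this]
  rw [Finset.sum_const, Finset.card_univ, card_signs, nsmul_eq_mul]
  push_cast
  rfl

theorem sum_steps_eq (F : (ι → ℤ) → ℝ) (u : ι → ℤ) :
    ∑ w : ι → Bool × ℤˣ × ℤˣ, F (fun i => u i * stepVal (w i)) =
      ∑ b : ι → Bool, ∑ e : ι → ℤˣ, ∑ e' : ι → ℤˣ,
        F (fun i => if b i then u i * e' i - u i * e i else 0) := by
  let E : (ι → Bool × ℤˣ × ℤˣ) ≃ (ι → Bool) × (ι → ℤˣ) × (ι → ℤˣ) :=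
    { toFun := fun w => (fun i => (w i).1, fun i => (w i).2.1, fun i => (w i).2.2)
      invFun := fun s i => (s.1 i, s.2.1 i, s.2.2 i)
      left_inv := fun _ => rfl
      right_inv := fun _ => rfl }
  rw [← E.symm.sum_comp, Fintype.sum_prod_type]
  refine Finset.sum_congr rfl fun b _ => ?_
  rw [Fintype.sum_prod_type]
  refine Finset.sum_congr rfl fun e _ => Finset.sum_congr rfl fun e' _ =>
    congrArg F (funext fun i => ?_)
  simp [E, stepVal, mul_sub]

theorem IsNegType.stepAvg_le_signAvg {F : (ι → ℤ) → ℝ} (hF : IsNegType F) (u : ι → ℤ) :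
    stepAvg F u ≤ signAvg F u := by
  have hneg : ∑ b : ι → Bool, ∑ e : ι → ℤˣ, ∑ e' : ι → ℤˣ,
      F (fun i => if b i then 0 else u i * e' i - u i * e i) =
      ∑ b : ι → Bool, ∑ e : ι → ℤˣ, ∑ e' : ι → ℤˣ,
      F (fun i => if b i then u i * e' i - u i * e i else 0) := by
    have hφ : Function.Involutive (fun (b : ι → Bool) i => !b i) := fun b => by simp
    rw [← Equiv.sum_comp (hφ.toPerm _)]
    refine Finset.sum_congr rfl fun b _ => Finset.sum_congr rfl fun e _ =>
      Finset.sum_congr rfl fun e' _ => congrArg F (funext fun i => ?_)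
    by_cases h : b i <;> simp [h]
  have hsum := Finset.sum_le_sum fun (b : ι → Bool) (_ : b ∈ Finset.univ) =>
    hF (fun e i => if b i then u i * e i else 0) (fun e i => if b i then 0 else u i * e i)
  have h1 : ∀ (b : ι → Bool) (e e' : ι → ℤˣ),
      ((fun i => if b i then u i * (e' i : ℤ) else 0) - fun i => if b i then u i * (e i : ℤ) else 0)
        = fun i => if b i then u i * (e' i : ℤ) - u i * e i else 0 := by
    intro b e e'
    funext i
    by_cases h : b i <;> simp [h]
  have h2 : ∀ (b : ι → Bool) (e e' : ι → ℤˣ),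
      ((fun i => if b i then 0 else u i * (e' i : ℤ)) - fun i => if b i then 0 else u i * (e i : ℤ))
        = fun i => if b i then 0 else u i * (e' i : ℤ) - u i * e i := by
    intro b e e'
    funext i
    by_cases h : b i <;> simp [h]
  have h3 : ∀ (b : ι → Bool) (e e' : ι → ℤˣ),
      ((fun i => if b i then 0 else u i * (e' i : ℤ)) - fun i => if b i then u i * (e i : ℤ) else 0)
        = fun i => (if b i then 0 else u i * (e' i : ℤ)) - if b i then u i * (e i : ℤ) else 0 :=
    fun b e e' => rfl
  simp only [h1, h2, h3, sum_mixed_signs, Finset.sum_add_distrib] at hsum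
  rw [hneg, ← sum_steps_eq, Finset.sum_const, Finset.card_univ, nsmul_eq_mul] at hsum
  unfold stepAvg signAvg
  rw [inv_mul_le_iff₀ (by positivity)]
  have hc : ((8 : ℝ) ^ Fintype.card ι) = 2 ^ Fintype.card ι * 2 ^ Fintype.card ι *
      2 ^ Fintype.card ι := by
    rw [← mul_pow, ← mul_pow]
    norm_num
  simp only [Fintype.card_pi, Fintype.card_bool, Finset.prod_const, Finset.card_univ] at hsum
  push_cast at hsum
  rw [hc, mul_assoc, mul_inv_cancel_left₀ (by positivity)]
  linarith

theorem IsNegType.iterate_stepAvg_le {F : (ι → ℤ) → ℝ} (hF : IsNegType F) (k : ℕ)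
    (u : ι → ℤ) : stepAvg^[k + 1] F u ≤ signAvg F u := by
  have hmono : ∀ (k : ℕ) {F F' : (ι → ℤ) → ℝ}, (∀ u, F u ≤ F' u) →
      ∀ u, stepAvg^[k] F u ≤ stepAvg^[k] F' u := by
    intro k
    induction k with
    | zero => exact fun h => h
    | succ k ih => exact fun h => ih (stepAvg_mono h)
  induction k with
  | zero => exact hF.stepAvg_le_signAvg u
  | succ k ih =>
    refine le_trans ?_ ih
    have h := hmono (k + 1) hF.stepAvg_le_signAvg u
    have hs : stepAvg (signAvg F) = stepAvg F := funext (stepAvg_signAvg F)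
    rwa [Function.iterate_succ_apply _ k (signAvg F), hs] at h

/-- The probability that `k` steps do not lead from `t` to `± 2 ^ N`. -/
noncomputable def missProb (N k : ℕ) (t : ℤ) : ℝ :=
  if |t| * 2 ^ k = 2 ^ N then 1 - (4 ^ k)⁻¹ else 1

theorem sum_missProb (N k : ℕ) (t : ℤ) :
    ∑ w : Bool × ℤˣ × ℤˣ, missProb N k (t * stepVal w) = 8 * missProb N (k + 1) t := by
  have h0 : missProb N k 0 = 1 := by simp [missProb, (pow_ne_zero N (two_ne_zero (α := ℤ))).symm]
  have h2 : missProb N k (t * (1 - -1)) = missProb N k (2 * t) := by congr 1; ring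
  have h3 : missProb N k (t * (-1 - 1)) = missProb N k (2 * t) := by
    simp [missProb, abs_mul, mul_comm]
  have h4 : missProb N k (2 * t) = 4 * missProb N (k + 1) t - 3 := by
    have : |2 * t| * 2 ^ k = |t| * 2 ^ (k + 1) := by
      rw [abs_mul, pow_succ, abs_two]; ring
    unfold missProb
    rw [this]
    split_ifs
    · rw [pow_succ, mul_inv]; ring
    · norm_num
  have hu : (Finset.univ : Finset ℤˣ) = {1, -1} := by decide
  simp only [Fintype.sum_prod_type, Fintype.sum_bool, hu]
  simp [stepVal, h0]
  norm_num at h2 h3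
  rw [h2, h3, h4]
  ring

theorem le_iterate_stepAvg {F : (ι → ℤ) → ℝ} {N : ℕ} {K : ℝ}
    (hF : ∀ u, K * (1 - ∏ i, missProb N 0 (u i)) ≤ F u) (k : ℕ) (u : ι → ℤ) :
    K * (1 - ∏ i, missProb N k (u i)) ≤ stepAvg^[k] F u := by
  induction k generalizing u with
  | zero => exact hF u
  | succ k ih =>
    rw [Function.iterate_succ_apply']
    refine le_trans (le_of_eq ?_) (stepAvg_mono ih u)
    unfold stepAvg
    have hprod : ∑ w : ι → Bool × ℤˣ × ℤˣ, ∏ i, missProb N k (u i * stepVal (w i)) =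
        8 ^ Fintype.card ι * ∏ i, missProb N (k + 1) (u i) := by
      have := Finset.prod_univ_sum (fun _ : ι => (Finset.univ : Finset (Bool × ℤˣ × ℤˣ)))
        (fun i w => missProb N k (u i * stepVal w))
      rw [Fintype.piFinset_univ] at this
      rw [← this]
      simp_rw [sum_missProb]
      rw [Finset.prod_mul_distrib, Finset.prod_const, Finset.card_univ]
    rw [← Finset.mul_sum, Finset.sum_sub_distrib, hprod, Finset.sum_const, Finset.card_univ,
      card_steps, nsmul_eq_mul]
    push_cast
    field_simp

end Averages

/-- The product of `4 ^ N` cyclic groups of order `2 ^ (N + 1)`. -/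
abbrev DiscreteTorus (N : ℕ) : Type := Fin (4 ^ N) → ZMod (2 ^ (N + 1))

/-- A kernel on a discrete torus of large dimension which satisfies the roundness inequality
cannot separate the pairs at half a period from the pairs of diagonal neighbours. -/
theorem far_le_two_mul_near {N : ℕ} (hN : N ≠ 0)
    (D : DiscreteTorus N → DiscreteTorus N → ℝ)
    (hD0 : ∀ x y, 0 ≤ D x y)
    (hD : ∀ x y : (Fin (4 ^ N) → ℤˣ) → DiscreteTorus N,
      ∑ i, ∑ j, (D (x i) (x j) + D (y i) (y j)) ≤ 2 * ∑ i, ∑ j, D (x i) (y j))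
    {a c : ℝ} (hc : 0 ≤ c)
    (hnear : ∀ x (e : Fin (4 ^ N) → ℤˣ), D x (fun i => x i + ((e i : ℤ) : ZMod _)) ≤ a)
    (hfar : ∀ x y, (∃ i, y i = x i + 2 ^ N) → c ≤ D x y) : c ≤ 2 * a := by
  let κ : (Fin (4 ^ N) → ℤ) → DiscreteTorus N := fun u i => (u i : ZMod _)
  let F : (Fin (4 ^ N) → ℤ) → ℝ := fun u => ∑ x : DiscreteTorus N, D x (x + κ u)
  have hshift : ∀ u v, ∑ x : DiscreteTorus N, D (x + κ u) (x + κ v) = F (v - u) := by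
    intro u v
    rw [← Equiv.sum_comp (Equiv.addRight (-κ u))]
    refine Finset.sum_congr rfl fun x _ => ?_
    congr 1
    · funext i; simp
    · funext i; simp [κ]; ring
  have hF : IsNegType F := by
    intro s t
    have h := Finset.sum_le_sum fun (x : DiscreteTorus N) (_ : x ∈ Finset.univ) =>
      hD (fun e => x + κ (s e)) (fun e => x + κ (t e))
    rw [← Finset.mul_sum, Finset.sum_comm, Finset.sum_comm (f := fun (x : DiscreteTorus N) i => ∑ j, _)] at h
    simp_rw [Finset.sum_comm (s := (Finset.univ : Finset (DiscreteTorus N))), Finset.sum_add_distrib, hshift] at h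
    simpa only [Finset.sum_add_distrib] using h
  have hlow : ∀ u, (Fintype.card (DiscreteTorus N) * c) * (1 - ∏ i, missProb N 0 (u i)) ≤ F u := by
    intro u
    by_cases h : ∃ i, |u i| = 2 ^ N
    · obtain ⟨i, hi⟩ := h
      have h0 : ∏ i, missProb N 0 (u i) = 0 :=
        Finset.prod_eq_zero (Finset.mem_univ i) (by simp [missProb, hi])
      rw [h0, sub_zero, mul_one, ← nsmul_eq_mul, ← Finset.card_univ, ← Finset.sum_const]
      refine Finset.sum_le_sum fun x _ => hfar _ _ ⟨i, ?_⟩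
      have h2 : (2 : ZMod (2 ^ (N + 1))) ^ N + 2 ^ N = 0 := by
        have := ZMod.natCast_self (2 ^ (N + 1))
        push_cast at this
        rw [← this]; ring
      rcases (abs_eq (by positivity)).1 hi with h | h
      · simp [κ, h]
      · simp only [Pi.add_apply, κ, h]
        push_cast
        rw [add_left_cancel_iff]
        exact neg_eq_of_add_eq_zero_left h2
    · push Not at h
      have h1 : ∏ i, missProb N 0 (u i) = 1 :=
        Finset.prod_eq_one fun i _ => by simp [missProb, h i]
      rw [h1, sub_self, mul_zero]
      exact Finset.sum_nonneg fun _ _ => hD0 _ _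
  obtain ⟨k, hk⟩ := Nat.exists_eq_succ_of_ne_zero hN
  have h1 := le_iterate_stepAvg hlow N (fun _ => 1)
  have h2 := hF.iterate_stepAvg_le k (fun _ => 1)
  rw [← Nat.succ_eq_add_one, ← hk] at h2
  have h3 : signAvg F (fun _ => 1) ≤ Fintype.card (DiscreteTorus N) * a := by
    unfold signAvg
    rw [inv_mul_le_iff₀ (by positivity)]
    have : ∀ e : Fin (4 ^ N) → ℤˣ,
        F (fun i => 1 * ((e i : ℤˣ) : ℤ)) ≤ Fintype.card (DiscreteTorus N) * a := by
      intro e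
      rw [← nsmul_eq_mul, ← Finset.card_univ, ← Finset.sum_const]
      refine Finset.sum_le_sum fun x _ => ?_
      refine (le_of_eq (congrArg (D x) (funext fun i => ?_))).trans (hnear x e)
      simp [κ]
    refine (Finset.sum_le_sum fun e _ => this e).trans (le_of_eq ?_)
    rw [Finset.sum_const, Finset.card_univ, card_signs, nsmul_eq_mul]
    push_cast
    rfl
  have h4 : ∏ _i : Fin (4 ^ N), missProb N N 1 ≤ 1 / 2 := by
    rw [Finset.prod_const, Finset.card_univ, Fintype.card_fin]
    simp only [missProb, abs_one, one_mul, if_true]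
    have h := Real.one_sub_div_pow_le_exp_neg (n := 4 ^ N) (t := 1)
      (by exact_mod_cast Nat.one_le_pow _ _ (by norm_num))
    push_cast at h
    rw [one_div] at h
    refine h.trans ?_
    have := Real.add_one_le_exp 1
    rw [Real.exp_neg, one_div]
    exact inv_anti₀ (by norm_num) (by linarith)
  have hG : (0 : ℝ) < Fintype.card (DiscreteTorus N) := by exact_mod_cast Fintype.card_pos
  have h5 : (Fintype.card (DiscreteTorus N) * c) * (1 / 2) ≤ Fintype.card (DiscreteTorus N) * a :=
    le_trans (mul_le_mul_of_nonneg_left (by linarith) (by positivity)) (h1.trans (h2.trans h3))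
  have h6 : (Fintype.card (DiscreteTorus N) : ℝ) * c ≤ Fintype.card (DiscreteTorus N) * (2 * a) := by linarith
  exact le_of_mul_le_mul_left h6 hG

/-- Rescaled copies of countably many finite metric spaces of diameter at most `1` can be put
together to a locally finite metric space. -/
theorem exists_locallyFinite_sigma (E : ℕ → Type) [∀ n, Finite (E n)]
    [∀ n, MetricSpace (E n)] (hE : ∀ n (x y : E n), dist x y ≤ 1) (s : ℕ → ℝ)
    (hs : ∀ n, 0 < s n) :
    ∃ _ : MetricSpace (Σ n, E n), LocallyFiniteSpace (Σ n, E n) ∧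
      ∀ n (x y : E n), dist (⟨n, x⟩ : Σ n, E n) ⟨n, y⟩ = s n * dist x y := by
  let c : ℕ → ℝ := fun n => s n + n + 1
  have hc : ∀ n, 0 < c n := fun n => by have := hs n; positivity
  have hsc : ∀ n (x y : E n), s n * dist x y ≤ c n := fun n x y => by
    have h1 := mul_le_mul_of_nonneg_left (hE n x y) (hs n).le
    have h2 : (0 : ℝ) ≤ n := n.cast_nonneg
    simp only [c]
    linarith
  have hsn : ∀ n (x y : E n), 0 ≤ s n * dist x y := fun n x y =>
    mul_nonneg (hs n).le dist_nonneg
  let d : (Σ n, E n) → (Σ n, E n) → ℝ := fun x y =>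
    if h : x.1 = y.1 then s y.1 * dist (h ▸ x.2) y.2 else c x.1 + c y.1
  have d_same : ∀ n (x y : E n), d ⟨n, x⟩ ⟨n, y⟩ = s n * dist x y := fun n x y => by simp [d]
  have d_ne : ∀ {m n} (x : E m) (y : E n), m ≠ n → d ⟨m, x⟩ ⟨n, y⟩ = c m + c n :=
    fun x y h => by simp [d, h]
  have d_comm : ∀ x y, d x y = d y x := by
    rintro ⟨m, x⟩ ⟨n, y⟩
    rcases eq_or_ne m n with rfl | h
    · rw [d_same, d_same, dist_comm]
    · rw [d_ne _ _ h, d_ne _ _ h.symm, add_comm]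
  have d_triangle : ∀ x y z, d x z ≤ d x y + d y z := by
    rintro ⟨m, x⟩ ⟨n, y⟩ ⟨k, z⟩
    have := hc m
    have := hc n
    have := hc k
    rcases eq_or_ne m n with rfl | hmn
    · rcases eq_or_ne m k with rfl | hmk
      · rw [d_same, d_same, d_same, ← mul_add]
        exact mul_le_mul_of_nonneg_left (dist_triangle _ _ _) (hs _).le
      · rw [d_same, d_ne _ _ hmk, d_ne _ _ hmk]
        linarith [hsn m x y]
    · rcases eq_or_ne n k with rfl | hnk
      · rw [d_same, d_ne _ _ hmn, d_ne _ _ hmn]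
        linarith [hsn n y z]
      · rw [d_ne _ _ hmn, d_ne _ _ hnk]
        rcases eq_or_ne m k with rfl | hmk
        · rw [d_same]
          linarith [hsc m x z]
        · rw [d_ne _ _ hmk]
          linarith
  let inst : MetricSpace (Σ n, E n) :=
    { dist := d
      dist_self := by
        rintro ⟨n, x⟩
        exact (d_same n x x).trans (by simp)
      dist_comm := d_comm
      dist_triangle := d_triangle
      eq_of_dist_eq_zero := by
        rintro ⟨m, x⟩ ⟨n, y⟩ h
        change d _ _ = 0 at h
        rcases eq_or_ne m n with rfl | hmn
        · rw [d_same, mul_eq_zero, dist_eq_zero] at h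
          rw [h.resolve_left (hs m).ne']
        · rw [d_ne _ _ hmn] at h
          linarith [hc m, hc n] }
  refine ⟨inst, fun t ht => ?_, d_same⟩
  rcases t.eq_empty_or_nonempty with rfl | ⟨⟨m, x⟩, hx⟩
  · exact Set.finite_empty
  obtain ⟨r, hr⟩ := Metric.isBounded_iff.1 ht
  obtain ⟨M, hM⟩ := exists_nat_gt r
  have hfin : (⋃ n ∈ Set.Iic (max M m), Set.range (Sigma.mk n : E n → Σ n, E n)).Finite :=
    (Set.finite_Iic _).biUnion fun n _ => Set.finite_range _
  refine hfin.subset ?_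
  rintro ⟨n, y⟩ hy
  simp only [Set.mem_iUnion, Set.mem_Iic]
  refine ⟨n, ?_, y, rfl⟩
  by_contra hn
  have hn' : M < n ∧ m < n := max_lt_iff.1 (not_le.1 hn)
  have h : d ⟨m, x⟩ ⟨n, y⟩ ≤ r := hr hx hy
  rw [d_ne _ _ hn'.2.ne] at h
  have h1 : (M : ℝ) < n := by exact_mod_cast hn'.1
  have h2 := hc m
  have h3 := hs n
  simp only [c] at h h2
  linarith

/-- The sup metric of the embedding of the discrete torus into a power of the unit circle. -/
@[reducible] noncomputable def DiscreteTorus.metricSpace (N : ℕ) : MetricSpace (DiscreteTorus N) :=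
  MetricSpace.induced (fun x i => ZMod.toAddCircle (x i))
    (fun _ _ h => funext fun i => ZMod.toAddCircle_injective _ (congrFun h i)) inferInstance

attribute [local instance] DiscreteTorus.metricSpace

theorem DiscreteTorus.dist_eq {N : ℕ} (x y : DiscreteTorus N) :
    dist x y = dist (fun i => ZMod.toAddCircle (x i)) (fun i => ZMod.toAddCircle (y i)) := rfl

theorem DiscreteTorus.dist_le_half {N : ℕ} (x y : DiscreteTorus N) : dist x y ≤ 1 / 2 := by
  rw [dist_eq, dist_pi_le_iff (by norm_num)]
  intro i
  rw [dist_eq_norm]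
  simpa using AddCircle.norm_le_half_period (1 : ℝ) (one_ne_zero)

theorem DiscreteTorus.dist_add_sign_le {N : ℕ} (x : DiscreteTorus N) (e : Fin (4 ^ N) → ℤˣ) :
    dist x (fun i => x i + ((e i : ℤ) : ZMod _)) ≤ (2 ^ (N + 1))⁻¹ := by
  rw [dist_eq, dist_pi_le_iff (by positivity)]
  intro i
  rw [map_add, dist_self_add_right, ZMod.toAddCircle_intCast]
  refine (QuotientAddGroup.norm_mk_le_norm).trans ?_
  rcases Int.units_eq_one_or (e i) with h | h <;> simp [h]

theorem DiscreteTorus.half_le_dist {N : ℕ} {x y : DiscreteTorus N}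
    (h : ∃ i, y i = x i + 2 ^ N) : 1 / 2 ≤ dist x y := by
  obtain ⟨i, hi⟩ := h
  rw [dist_eq]
  refine le_trans (le_of_eq ?_) (dist_le_pi_dist _ _ i)
  have h2 : (2 ^ N : ZMod (2 ^ (N + 1))) = ((2 ^ N : ℕ) : ZMod (2 ^ (N + 1))) := by push_cast; rfl
  rw [hi, map_add, dist_self_add_right, h2, ZMod.toAddCircle_natCast]
  have h3 : ((2 ^ N : ℕ) / (2 ^ (N + 1) : ℕ) : ℝ) = 1 / 2 := by
    push_cast
    rw [pow_succ]
    field_simp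
  rw [h3, AddCircle.norm_half_period_eq, abs_one]

/-- For any scales there is a locally finite metric space whose maps into spaces with the
roundness inequality for `p` cannot separate distances `s N / 2` from `s N / 2 ^ (N + 1)`. -/
theorem exists_locallyFinite_obstruction (s : ℕ → ℝ) (hs : ∀ N, 0 < s N) :
    ∃ (Z : Type) (_ : MetricSpace Z), LocallyFiniteSpace Z ∧
      ∀ {B : Type*} [MetricSpace B] {p : ℝ}, 0 < p → p ∈ grSet (dist : B → B → ℝ) →
      ∀ (h : Z → B) (N : ℕ), N ≠ 0 → ∀ a c : ℝ, 0 ≤ a → 0 ≤ c →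
        (∀ x y, dist x y ≤ s N * (2 ^ (N + 1))⁻¹ → dist (h x) (h y) ≤ a) →
        (∀ x y, s N * (1 / 2) ≤ dist x y → c ≤ dist (h x) (h y)) → c ^ p ≤ 2 * a ^ p := by
  obtain ⟨inst, hlf, hdist⟩ := exists_locallyFinite_sigma DiscreteTorus
    (fun n x y => (DiscreteTorus.dist_le_half x y).trans (by norm_num)) s hs
  refine ⟨_, inst, hlf, fun {B} _ {p} hp hpB h N hN a c ha hc hnear hfar => ?_⟩
  refine far_le_two_mul_near hN (fun x y => dist (h ⟨N, x⟩) (h ⟨N, y⟩) ^ p)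
    (fun _ _ => by positivity) (fun x y => ?_) (by positivity) (fun x e => ?_) fun x y hxy => ?_
  · refine grSet.sum_le hp hpB ?_ (fun i => h ⟨N, x i⟩) (fun i => h ⟨N, y i⟩)
    rw [card_signs, Fintype.card_fin]
    exact Nat.le_self_pow (by positivity) 2
  · refine Real.rpow_le_rpow dist_nonneg (hnear _ _ ?_) hp.le
    rw [hdist]
    exact mul_le_mul_of_nonneg_left (DiscreteTorus.dist_add_sign_le x e) (hs N).le
  · refine Real.rpow_le_rpow hc (hfar _ _ ?_) hp.le
    rw [hdist]
    exact mul_le_mul_of_nonneg_left (DiscreteTorus.half_le_dist hxy) (hs N).le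

theorem exists_pos_mem_grSet {B : Type*} {d : B → B → ℝ} (h : 0 < genRoundness d) :
    ∃ p, 0 < p ∧ p ∈ grSet d := by
  obtain ⟨_, ⟨p, hp, rfl⟩, hpos⟩ := lt_sSup_iff.1 h
  exact ⟨p, ENNReal.ofReal_pos.1 hpos, hp⟩

/-- Corollary 2 of the paper: any metric space `Y` that is Lipschitz
universal for all locally finite metric spaces is neither uniformly nor coarsely
embeddable into any metric space of non zero generalized roundness. -/
theorem lipschitz_universal_not_embeddable {Y : Type*} [MetricSpace Y]
    (huniv : ∀ (Z : Type) [MetricSpace Z], LocallyFiniteSpace Z →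
      ∃ g : Z → Y, IsLipschitzEmbeddingWith (dist : Z → Z → ℝ) (dist : Y → Y → ℝ) g)
    {B : Type*} [MetricSpace B] (hB : 0 < genRoundness (dist : B → B → ℝ)) :
    (¬∃ f : Y → B, IsUniformEmbeddingWith (dist : Y → Y → ℝ) (dist : B → B → ℝ) f) ∧
    (¬∃ f : Y → B, IsCoarseEmbeddingWith (dist : Y → Y → ℝ) (dist : B → B → ℝ) f) := by
  obtain ⟨p, hp, hpB⟩ := exists_pos_mem_grSet hB
  constructor
  · rintro ⟨f, -, hf, hf'⟩
    obtain ⟨Z, _, hlf, hZ⟩ := exists_locallyFinite_obstruction (fun _ => 2) fun _ => two_pos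
    obtain ⟨g, -, C₁, C₂, hC₁, hg⟩ := huniv Z hlf
    obtain ⟨c, hc, hfar⟩ := hf' C₁ hC₁
    obtain ⟨δ, hδ, hnear⟩ := hf (c * 4⁻¹ ^ p⁻¹) (by positivity)
    obtain ⟨k, hk⟩ := exists_pow_lt_of_lt_one (y := (1 / 2 : ℝ))
      (show 0 < δ / (|C₂| + 1) by positivity) (by norm_num)
    have key : c ^ p ≤ 2 * (c * 4⁻¹ ^ p⁻¹) ^ p := by
      refine hZ hp hpB (f ∘ g) (k + 1) k.succ_ne_zero
        (c * 4⁻¹ ^ p⁻¹) c (by positivity) hc.le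
        (fun x y hxy => (hnear _ _ ?_).le) fun x y hxy => ?_
      · rw [lt_div_iff₀ (by positivity)] at hk
        have h1 : dist x y ≤ (1 / 2) ^ k := hxy.trans (by
          rw [one_div, inv_pow, pow_succ, pow_succ, mul_inv, mul_inv]
          nlinarith [show (0 : ℝ) < (2 ^ k)⁻¹ by positivity])
        calc dist (g x) (g y) ≤ C₂ * dist x y := (hg x y).2
          _ ≤ |C₂| * (1 / 2) ^ k := mul_le_mul (le_abs_self _) h1 dist_nonneg (abs_nonneg _)
          _ ≤ (1 / 2) ^ k * (|C₂| + 1) := by linarith [show (0 : ℝ) < (1 / 2) ^ k by positivity]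
          _ < δ := hk
      · by_contra! hlt
        have h1 := hfar _ _ hlt
        have h2 := (hg x y).1
        nlinarith
    rw [Real.mul_rpow hc.le (by positivity), ← Real.rpow_mul (by norm_num),
      inv_mul_cancel₀ hp.ne', Real.rpow_one] at key
    linarith [Real.rpow_pos_of_pos hc p]
  · rintro ⟨f, ρ₁, ρ₂, hρ₁, hρ₂, hf, hlim⟩
    obtain ⟨Z, _, hlf, hZ⟩ := exists_locallyFinite_obstruction (fun N => 2 ^ (N + 1))
      fun _ => by positivity
    obtain ⟨g, -, C₁, C₂, hC₁, hg⟩ := huniv Z hlf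
    have hscale : Filter.Tendsto (fun N : ℕ => ρ₁ (C₁ * 2 ^ N)) Filter.atTop Filter.atTop :=
      hlim.comp ((tendsto_pow_atTop_atTop_of_one_lt one_lt_two).const_mul_atTop hC₁)
    obtain ⟨N, hN, hN0, hNpos⟩ := ((((tendsto_rpow_atTop hp).comp hscale).eventually_gt_atTop
      (2 * |ρ₂ (|C₂|)| ^ p)).and ((Filter.eventually_ne_atTop 0).and
      (hscale.eventually_ge_atTop 0))).exists
    refine hN.not_ge (hZ hp hpB (f ∘ g) N hN0 |ρ₂ (|C₂|)| (ρ₁ (C₁ * 2 ^ N)) (abs_nonneg _)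
      hNpos (fun x y hxy => ?_) fun x y hxy => ?_)
    · rw [mul_inv_cancel₀ (by positivity)] at hxy
      refine ((hf _ _).2.trans (hρ₂ ?_)).trans (le_abs_self _)
      calc dist (g x) (g y) ≤ C₂ * dist x y := (hg x y).2
        _ ≤ |C₂| * 1 := mul_le_mul (le_abs_self _) hxy dist_nonneg (abs_nonneg _)
        _ = |C₂| := mul_one _
    · refine (hρ₁ (le_trans ?_ (hg x y).1)).trans (hf _ _).1
      refine mul_le_mul_of_nonneg_left (le_trans (le_of_eq ?_) hxy) hC₁.le
      rw [pow_succ]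
      ring
end
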